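/- Let χ > 0 satisfy χ < √(6√3 + 9)/2, and let B1, B2 satisfy (B) and hypothesis (H1). Then for each pair (u0, v0) fulfilling (init), there exists C > 0 such that the global classical solution (u, v) of the crime model satisfies v(x,t) ≤ C for all x ∈ Ω and t > 0. Furthermore, if hypothesis (H3) holds with some B_{2,∞} ∈ L²(Ω), then v(·,t) → v_∞ in L^∞(Ω) as t → ∞, where v_∞ is the solution of the stationary Neumann problem −(v_∞)_xx + v_∞ = B_{2,∞} in Ω with (v_∞)_x = 0 on ∂Ω. -/

import Mathlib

open Real MeasureTheory Filter Topology Set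
open scoped ENNReal NNReal

noncomputable section

/-- Partial derivative of a space-time function in the first (space) variable. -/
def pdx (f : ℝ → ℝ → ℝ) : ℝ → ℝ → ℝ := fun x t => deriv (fun y => f y t) x

/-- Partial derivative of a space-time function in the second (time) variable. -/
def pdt (f : ℝ → ℝ → ℝ) : ℝ → ℝ → ℝ := fun x t => deriv (fun s => f x s) t

/-- The time interval `[0, Tmax)` (with `Tmax ∈ (0,∞]`). -/
def It (Tmax : ℝ≥0∞) : Set ℝ := {t : ℝ | 0 ≤ t ∧ ENNReal.ofReal t < Tmax}

/-- The time interval `(0, Tmax)` (with `Tmax ∈ (0,∞]`). -/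
def It' (Tmax : ℝ≥0∞) : Set ℝ := {t : ℝ | 0 < t ∧ ENNReal.ofReal t < Tmax}

/-- The waiting time `τ := min{1, Tmax/3}`, as a real number. -/
def tauOf (Tmax : ℝ≥0∞) : ℝ := (min 1 (Tmax / 3)).toReal

/-- Hypothesis (B): `B` is nonnegative, bounded, and locally Hölder continuous on
`Ω̄ × [0,∞)` with some exponent `ϑ ∈ (0,1)`. -/
def HypB (a b : ℝ) (B : ℝ → ℝ → ℝ) : Prop :=
  (∀ x t : ℝ, 0 ≤ B x t) ∧ (∃ M : ℝ, ∀ x t : ℝ, B x t ≤ M) ∧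
  ∃ ϑ : ℝ, ϑ ∈ Set.Ioo (0:ℝ) 1 ∧
    ∀ K : Set (ℝ × ℝ), IsCompact K → K ⊆ (Set.Icc a b) ×ˢ (Set.Ici (0:ℝ)) →
      ∃ C : ℝ, ∀ p ∈ K, ∀ q ∈ K, |B p.1 p.2 - B q.1 q.2| ≤ C * dist p q ^ ϑ

/-- Hypothesis (init): `u0 ∈ C⁰(Ω̄)` nonnegative, `v0 ∈ W^{1,∞}(Ω)` (i.e. Lipschitz)
positive on `Ω̄`. -/
def HypInit (a b : ℝ) (u0 v0 : ℝ → ℝ) : Prop :=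
  ContinuousOn u0 (Set.Icc a b) ∧ (∀ x ∈ Set.Icc a b, 0 ≤ u0 x) ∧
  (∃ L : ℝ≥0, LipschitzOnWith L v0 (Set.Icc a b)) ∧ (∀ x ∈ Set.Icc a b, 0 < v0 x)

/-- Hypothesis (H1): `∫_0^∞ ∫_Ω B1 < ∞`. -/
def HypH1 (a b : ℝ) (B1 : ℝ → ℝ → ℝ) : Prop :=
  MeasureTheory.IntegrableOn (fun p : ℝ × ℝ => B1 p.1 p.2)
    ((Set.Ioo a b) ×ˢ (Set.Ioi (0:ℝ)))

/-- Hypothesis (H1'): `∫_t^{t+1} ∫_Ω B1 → 0` as `t → ∞`. -/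
def HypH1' (a b : ℝ) (B1 : ℝ → ℝ → ℝ) : Prop :=
  Filter.Tendsto (fun t : ℝ => ∫ s in t..(t+1), ∫ x in Set.Ioo a b, B1 x s)
    Filter.atTop (nhds 0)

/-- Hypothesis (H2): `inf_{t>0} ∫_Ω B2(·,t) > 0`. -/
def HypH2 (a b : ℝ) (B2 : ℝ → ℝ → ℝ) : Prop :=
  ∃ c : ℝ, 0 < c ∧ ∀ t : ℝ, 0 < t → c ≤ ∫ x in Set.Ioo a b, B2 x t

/-- Hypothesis (H3): `B2(·,t)` stabilizes to `B2inf ∈ L²(Ω)` in the averaged `L²` sense. -/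
def HypH3 (a b : ℝ) (B2 : ℝ → ℝ → ℝ) (B2inf : ℝ → ℝ) : Prop :=
  MeasureTheory.MemLp B2inf 2 (MeasureTheory.volume.restrict (Set.Ioo a b)) ∧
  Filter.Tendsto
    (fun t : ℝ => ∫ s in t..(t+1), ∫ x in Set.Ioo a b, (B2 x s - B2inf x)^2)
    Filter.atTop (nhds 0)

/-- A classical solution of the urban crime system
`u_t = u_xx − χ (u/v · v_x)_x − uv + B1`, `v_t = v_xx + uv − v + B2` on
`Ω̄ × [0, Tmax)`, `Ω = (a,b)`, with homogeneous Neumann boundary conditions and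
initial data `(u0, v0)`; `u, v` are positive on `Ω̄ × (0, Tmax)`, belong to
`C⁰(Ω̄ × [0,Tmax)) ∩ C^{2,1}(Ω̄ × (0,Tmax))` and `v(·,t)` lies in `W^{1,r}(Ω)`,
continuously in `t`, for every `r > 1`. -/
structure CrimeSol (a b χ : ℝ) (B1 B2 : ℝ → ℝ → ℝ) (u0 v0 : ℝ → ℝ)
    (u v : ℝ → ℝ → ℝ) (Tmax : ℝ≥0∞) : Prop where
  u_cont : ContinuousOn (fun p : ℝ × ℝ => u p.1 p.2) ((Set.Icc a b) ×ˢ It Tmax)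
  v_cont : ContinuousOn (fun p : ℝ × ℝ => v p.1 p.2) ((Set.Icc a b) ×ˢ It Tmax)
  u_init : ∀ x ∈ Set.Icc a b, u x 0 = u0 x
  v_init : ∀ x ∈ Set.Icc a b, v x 0 = v0 x
  u_pos : ∀ x ∈ Set.Icc a b, ∀ t ∈ It' Tmax, 0 < u x t
  v_pos : ∀ x ∈ Set.Icc a b, ∀ t ∈ It' Tmax, 0 < v x t
  u_reg : ∀ x ∈ Set.Icc a b, ∀ t ∈ It' Tmax,
    DifferentiableAt ℝ (fun y => u y t) x ∧
    DifferentiableAt ℝ (fun y => pdx u y t) x ∧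
    DifferentiableAt ℝ (fun s => u x s) t
  v_reg : ∀ x ∈ Set.Icc a b, ∀ t ∈ It' Tmax,
    DifferentiableAt ℝ (fun y => v y t) x ∧
    DifferentiableAt ℝ (fun y => pdx v y t) x ∧
    DifferentiableAt ℝ (fun s => v x s) t
  u_cont21 : ContinuousOn
    (fun p : ℝ × ℝ => (pdx u p.1 p.2, pdx (pdx u) p.1 p.2, pdt u p.1 p.2))
    ((Set.Icc a b) ×ˢ It' Tmax)
  v_cont21 : ContinuousOn
    (fun p : ℝ × ℝ => (pdx v p.1 p.2, pdx (pdx v) p.1 p.2, pdt v p.1 p.2))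
    ((Set.Icc a b) ×ˢ It' Tmax)
  v_W1r : ∀ r : ℝ, 1 < r →
    (∀ t ∈ It Tmax,
      MeasureTheory.IntegrableOn (fun x => |pdx v x t| ^ r) (Set.Ioo a b)) ∧
    ContinuousOn (fun t => ∫ x in Set.Ioo a b, |pdx v x t| ^ r) (It Tmax)
  u_eq : ∀ x ∈ Set.Ioo a b, ∀ t ∈ It' Tmax,
    pdt u x t = pdx (pdx u) x t
      - χ * pdx (fun y s => u y s / v y s * pdx v y s) x t
      - u x t * v x t + B1 x t
  v_eq : ∀ x ∈ Set.Ioo a b, ∀ t ∈ It' Tmax,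
    pdt v x t = pdx (pdx v) x t + u x t * v x t - v x t + B2 x t
  u_bc : ∀ t ∈ It' Tmax, pdx u a t = 0 ∧ pdx u b t = 0
  v_bc : ∀ t ∈ It' Tmax, pdx v a t = 0 ∧ pdx v b t = 0

/-- A classical solution of the stationary Neumann problem
`−w'' + w = B` in `Ω = (a,b)`, `w' = 0` on `∂Ω`. -/
def IsStationarySol (a b : ℝ) (B : ℝ → ℝ) (w : ℝ → ℝ) : Prop :=
  ContinuousOn w (Set.Icc a b) ∧
  (∀ x ∈ Set.Icc a b, DifferentiableAt ℝ w x ∧ DifferentiableAt ℝ (deriv w) x) ∧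
  (∀ x ∈ Set.Ioo a b, -(deriv (deriv w) x) + w x = B x) ∧
  deriv w a = 0 ∧ deriv w b = 0

/-- The branches `q^±(p) = (1−p)/2 · (1 ∓/± √(1 − pχ²))`. -/
def qminus (χ p : ℝ) : ℝ := (1 - p) / 2 * (1 - Real.sqrt (1 - p * χ^2))

def qplus (χ p : ℝ) : ℝ := (1 - p) / 2 * (1 + Real.sqrt (1 - p * χ^2))

/-- The auxiliary functions `φ₁, φ₂, φ₃` and the constant `p₀`. -/
def phi1 (p : ℝ) : ℝ := (p + 1) / (1 - p)

def phi2 (χ p : ℝ) : ℝ := (1 - p) / (2 * p) * (1 + Real.sqrt (1 - p * χ^2))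

def phi3 (χ p : ℝ) : ℝ := (1 - p) / (2 * p) * (1 - Real.sqrt (1 - p * χ^2))

def p0 : ℝ := (2 * Real.sqrt 3 - 3) / 3

/-! ### Analytic tools -/

/-- Joint continuity on `[a,b] × (0,∞)`. -/
def CO (a b : ℝ) (f : ℝ → ℝ → ℝ) : Prop :=
  ContinuousOn (fun p : ℝ × ℝ => f p.1 p.2) (Icc a b ×ˢ Ioi (0:ℝ))

lemma CO.slice {a b : ℝ} {f : ℝ → ℝ → ℝ} (hf : CO a b f) {t : ℝ} (ht : 0 < t) :
    ContinuousOn (fun x => f x t) (Icc a b) := by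
  have h : ContinuousOn (fun x : ℝ => (x, t)) (Icc a b) := by fun_prop
  exact ContinuousOn.comp hf h (fun x hx => ⟨hx, ht⟩)

lemma CO.slice' {a b : ℝ} {f : ℝ → ℝ → ℝ} (hf : CO a b f) {x : ℝ} (hx : x ∈ Icc a b) :
    ContinuousOn (fun t => f x t) (Ioi 0) := by
  have h : ContinuousOn (fun t : ℝ => (x, t)) (Ioi 0) := by fun_prop
  exact ContinuousOn.comp (g := fun p : ℝ × ℝ => f p.1 p.2) hf h (fun t ht => ⟨hx, ht⟩)

lemma CO.ii {a b : ℝ} (hab : a ≤ b) {f : ℝ → ℝ → ℝ} (hf : CO a b f) {t : ℝ} (ht : 0 < t) :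
    IntervalIntegrable (fun x => f x t) volume a b :=
  (hf.slice ht).intervalIntegrable_of_Icc hab

lemma CO.bdd {a b : ℝ} {f : ℝ → ℝ → ℝ} (hf : CO a b f) {t : ℝ} (ht : 0 < t) :
    ∃ K : ℝ, 0 ≤ K ∧ ∀ x ∈ Icc a b, ∀ s ∈ Icc (t/2) (t+1), |f x s| ≤ K := by
  have hc : IsCompact (Icc a b ×ˢ Icc (t/2) (t+1)) := isCompact_Icc.prod isCompact_Icc
  have hs : (Icc a b ×ˢ Icc (t/2) (t+1)) ⊆ (Icc a b ×ˢ Ioi (0:ℝ)) := by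
    rintro ⟨x, s⟩ ⟨hx, hs⟩
    exact ⟨hx, lt_of_lt_of_le (by positivity) hs.1⟩
  obtain ⟨K, hK⟩ := hc.exists_bound_of_continuousOn (ContinuousOn.mono hf hs)
  refine ⟨max K 0, le_max_right _ _, fun x hx s hs' => ?_⟩
  exact (hK (x, s) ⟨hx, hs'⟩).trans (le_max_left _ _)

lemma nhds_half {t : ℝ} (ht : 0 < t) : Icc (t/2) (t+1) ∈ 𝓝 t :=
  Icc_mem_nhds (by linarith) (by linarith)

lemma CO.cont_int {a b : ℝ} (hab : a ≤ b) {f : ℝ → ℝ → ℝ} (hf : CO a b f) :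
    ContinuousOn (fun t => ∫ x in a..b, f x t) (Ioi 0) := by
  intro t ht
  apply ContinuousAt.continuousWithinAt
  obtain ⟨K, hK0, hK⟩ := hf.bdd (t := t) ht
  apply intervalIntegral.tendsto_integral_filter_of_dominated_convergence (fun _ => K)
  · filter_upwards [Ioi_mem_nhds (show (0:ℝ) < t from ht)] with s hs
    rw [uIoc_of_le hab]
    exact ((hf.slice hs).mono Ioc_subset_Icc_self).aestronglyMeasurable measurableSet_Ioc
  · filter_upwards [nhds_half ht] with s hs
    refine Eventually.of_forall fun x hx => ?_
    rw [uIoc_of_le hab] at hx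
    exact hK x (Ioc_subset_Icc_self hx) s hs
  · exact intervalIntegrable_const
  · refine Eventually.of_forall fun x hx => ?_
    rw [uIoc_of_le hab] at hx
    exact ((hf.slice' (Ioc_subset_Icc_self hx)).continuousAt (Ioi_mem_nhds ht))

lemma CO.deriv_int {a b : ℝ} (hab : a ≤ b) {f ft : ℝ → ℝ → ℝ} (hf : CO a b f)
    (hft : CO a b ft)
    (hd : ∀ x ∈ Icc a b, ∀ t : ℝ, 0 < t → HasDerivAt (fun s => f x s) (ft x t) t)
    {t : ℝ} (ht : 0 < t) :
    HasDerivAt (fun s => ∫ x in a..b, f x s) (∫ x in a..b, ft x t) t := by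
  obtain ⟨K, hK0, hK⟩ := hft.bdd (t := t) ht
  refine (intervalIntegral.hasDerivAt_integral_of_dominated_loc_of_deriv_le
    (F := fun s x => f x s) (F' := fun s x => ft x s) (bound := fun _ => K)
    (nhds_half ht) ?_ (hf.ii hab ht) ?_ ?_ intervalIntegrable_const ?_).2
  · filter_upwards [Ioi_mem_nhds (show (0:ℝ) < t from ht)] with s hs
    rw [uIoc_of_le hab]
    exact ((hf.slice hs).mono Ioc_subset_Icc_self).aestronglyMeasurable measurableSet_Ioc
  · rw [uIoc_of_le hab]
    exact ((hft.slice ht).mono Ioc_subset_Icc_self).aestronglyMeasurable measurableSet_Ioc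
  · refine Eventually.of_forall fun x hx s hs => ?_
    rw [uIoc_of_le hab] at hx
    exact hK x (Ioc_subset_Icc_self hx) s hs
  · refine Eventually.of_forall fun x hx s hs => ?_
    rw [uIoc_of_le hab] at hx
    exact hd x (Ioc_subset_Icc_self hx) s (lt_of_lt_of_le (by positivity) hs.1)

/-- Time derivative of `∫ f` when `f_t = φ_x + r` with `φ` vanishing at the boundary. -/
lemma deriv_flux {a b : ℝ} (hab : a ≤ b) {f ft φ φx r : ℝ → ℝ → ℝ} (hf : CO a b f)
    (hft : CO a b ft) (hφx : CO a b φx) (hr : CO a b r)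
    (hd : ∀ x ∈ Icc a b, ∀ t : ℝ, 0 < t → HasDerivAt (fun s => f x s) (ft x t) t)
    (hdφ : ∀ x ∈ Icc a b, ∀ t : ℝ, 0 < t → HasDerivAt (fun y => φ y t) (φx x t) x)
    (h0 : ∀ t : ℝ, 0 < t → φ a t = 0 ∧ φ b t = 0)
    (heq : ∀ x ∈ Icc a b, ∀ t : ℝ, 0 < t → ft x t = φx x t + r x t)
    {t : ℝ} (ht : 0 < t) :
    HasDerivAt (fun s => ∫ x in a..b, f x s) (∫ x in a..b, r x t) t := by
  have h := hf.deriv_int hab hft hd ht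
  have h1 : ∫ x in a..b, ft x t = ∫ x in a..b, (φx x t + r x t) := by
    apply intervalIntegral.integral_congr
    intro x hx
    rw [uIcc_of_le hab] at hx
    exact heq x hx t ht
  have h2 : ∫ x in a..b, φx x t = 0 := by
    rw [intervalIntegral.integral_eq_sub_of_hasDerivAt (f := fun y => φ y t)
      (fun x hx => hdφ x (by rwa [uIcc_of_le hab] at hx) t ht) (hφx.ii hab ht)]
    rw [(h0 t ht).1, (h0 t ht).2, sub_zero]
  rw [h1, intervalIntegral.integral_add (hφx.ii hab ht) (hr.ii hab ht), h2, zero_add] at h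
  exact h

/-- One-dimensional Sobolev-type bound. -/
lemma sup_bound {a b : ℝ} (hab : a < b) {f f1 g : ℝ → ℝ}
    (hd : ∀ x ∈ Icc a b, HasDerivAt f (f1 x) x) (hf1 : ContinuousOn f1 (Icc a b))
    (hg : ContinuousOn g (Icc a b)) (hfg : ∀ x ∈ Icc a b, |f1 x| ≤ g x)
    {x : ℝ} (hx : x ∈ Icc a b) :
    f x ≤ (1 / (b - a)) * (∫ y in a..b, f y) + ∫ y in a..b, g y := by
  have hfc : ContinuousOn f (Icc a b) := fun y hy => (hd y hy).continuousAt.continuousWithinAt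
  have hgi : IntervalIntegrable g volume a b := hg.intervalIntegrable_of_Icc hab.le
  have hg0 : ∀ y ∈ Icc a b, 0 ≤ g y := fun y hy => (abs_nonneg _).trans (hfg y hy)
  have key : ∀ y z : ℝ, y ∈ Icc a b → z ∈ Icc a b → y ≤ z →
      |f z - f y| ≤ ∫ w in a..b, g w := by
    intro y z hy hz hyz
    have hsub : Icc y z ⊆ Icc a b := Icc_subset_Icc hy.1 hz.2
    have h1 : ∫ w in y..z, f1 w = f z - f y := by
      apply intervalIntegral.integral_eq_sub_of_hasDerivAt
      · intro w hw
        rw [uIcc_of_le hyz] at hw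
        exact hd w (hsub hw)
      · exact (hf1.mono hsub).intervalIntegrable_of_Icc hyz
    rw [← h1]
    have h2 : |∫ w in y..z, f1 w| ≤ ∫ w in y..z, |f1 w| :=
      intervalIntegral.abs_integral_le_integral_abs hyz
    have h3 : ∫ w in y..z, |f1 w| ≤ ∫ w in y..z, g w := by
      apply intervalIntegral.integral_mono_on hyz
      · exact ((hf1.mono hsub).abs).intervalIntegrable_of_Icc hyz
      · exact (hg.mono hsub).intervalIntegrable_of_Icc hyz
      · exact fun w hw => hfg w (hsub hw)
    have h4 : ∫ w in y..z, g w ≤ ∫ w in a..b, g w := by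
      apply intervalIntegral.integral_mono_interval hy.1 hyz hz.2 _ hgi
      refine (ae_restrict_iff' measurableSet_Ioc).2 (Eventually.of_forall fun w hw => ?_)
      exact hg0 w (Ioc_subset_Icc_self hw)
    linarith
  have key2 : ∀ y ∈ Icc a b, f x - (∫ w in a..b, g w) ≤ f y := by
    intro y hy
    rcases le_total x y with h | h
    · have := abs_le.1 (key x y hx hy h); linarith
    · have := abs_le.1 (key y x hy hx h); linarith
  have h5 : ∫ y in a..b, (f x - ∫ w in a..b, g w) ≤ ∫ y in a..b, f y := by
    apply intervalIntegral.integral_mono_on hab.le intervalIntegrable_const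
      (hfc.intervalIntegrable_of_Icc hab.le) key2
  rw [intervalIntegral.integral_const, smul_eq_mul] at h5
  have hL : 0 < b - a := sub_pos.2 hab
  have h6 : f x - (∫ w in a..b, g w) ≤ (1 / (b - a)) * (∫ y in a..b, f y) := by
    rw [one_div, inv_mul_eq_div, le_div_iff₀ hL]; linarith
  linarith

/-- If `H' ≤ φ` then `H(t) - H(s) ≤ ∫ φ`. -/
lemma sub_le_int {H H' φ : ℝ → ℝ} (hd : ∀ t : ℝ, 0 < t → HasDerivAt H (H' t) t)
    (hφ : ContinuousOn φ (Ioi 0)) {s t : ℝ} (hs : 0 < s)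
    (hst : s ≤ t) (hle : ∀ r : ℝ, s ≤ r → H' r ≤ φ r) : H t - H s ≤ ∫ r in s..t, φ r := by
  have hsub : Icc s t ⊆ Ioi 0 := fun _ hr => lt_of_lt_of_le hs hr.1
  apply intervalIntegral.sub_le_integral_of_hasDeriv_right_of_le hst (g' := H')
  · exact fun r hr => (hd r (hsub hr)).continuousAt.continuousWithinAt
  · exact fun r hr => (hd r (hsub (Ioo_subset_Icc_self hr))).hasDerivWithinAt
  · exact (hφ.mono hsub).integrableOn_Icc
  · exact fun r hr => hle r hr.1.le

lemma ii_of_pos {φ : ℝ → ℝ} (hφ : ContinuousOn φ (Ioi 0)) {s t : ℝ} (hs : 0 < s) (hst : s ≤ t) :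
    IntervalIntegrable φ volume s t :=
  (hφ.mono (fun _ hr => lt_of_lt_of_le hs hr.1)).intervalIntegrable_of_Icc hst

/-- Linear damped ODE inequality with uniformly locally integrable source. -/
lemma ode_bound {H H' φ : ℝ → ℝ} {κ K T : ℝ} (hκ : 0 < κ) (hT : 0 < T)
    (hd : ∀ t : ℝ, 0 < t → HasDerivAt H (H' t) t)
    (hφ : ContinuousOn φ (Ioi 0)) (hφ0 : ∀ t : ℝ, 0 < t → 0 ≤ φ t)
    (hle : ∀ t : ℝ, T ≤ t → H' t ≤ - κ * H t + φ t)
    (hK : ∀ t : ℝ, T ≤ t → ∫ r in t..(t+1), φ r ≤ K) :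
    ∀ t : ℝ, T ≤ t → H t ≤ Real.exp (-κ * (t - T)) * H T + (K / (1 - Real.exp (-κ)) + K) := by
  have hone : ∀ t s : ℝ, T ≤ t → t ≤ s → s ≤ t + 1 →
      H s ≤ Real.exp (-κ * (s - t)) * H t + K := by
    intro t s ht hts hs1
    have ht0 : 0 < t := lt_of_lt_of_le hT ht
    have h := sub_le_int (H := fun r => Real.exp (κ * (r - s)) * H r)
      (H' := fun r => (Real.exp (κ * (r - s)) * κ) * H r + Real.exp (κ * (r - s)) * H' r)
      (φ := fun r => Real.exp (κ * (r - s)) * φ r) ?_ ?_ ht0 hts ?_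
    · have h2 : ∫ r in t..s, Real.exp (κ * (r - s)) * φ r ≤ ∫ r in t..s, φ r := by
        apply intervalIntegral.integral_mono_on hts
        · exact ii_of_pos (ContinuousOn.mul (by fun_prop) hφ) ht0 hts
        · exact ii_of_pos hφ ht0 hts
        · intro r hr
          have h3 : Real.exp (κ * (r - s)) ≤ 1 := by
            rw [Real.exp_le_one_iff]
            have := hr.2
            nlinarith
          have h4 := hφ0 r (lt_of_lt_of_le ht0 hr.1)
          nlinarith
      have h5 : ∫ r in t..s, φ r ≤ ∫ r in t..(t+1), φ r := by
        apply intervalIntegral.integral_mono_interval le_rfl hts hs1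
        · refine (ae_restrict_iff' measurableSet_Ioc).2 (Eventually.of_forall fun w hw => ?_)
          exact hφ0 w (ht0.trans hw.1)
        · exact ii_of_pos hφ ht0 (by linarith)
      have h6 := hK t ht
      simp only [sub_self, mul_zero, Real.exp_zero, one_mul] at h
      have h7 : κ * (t - s) = -κ * (s - t) := by ring
      rw [h7] at h
      linarith
    · intro r hr
      have h1 : HasDerivAt (fun r => Real.exp (κ * (r - s))) (Real.exp (κ * (r - s)) * κ) r := by
        have : HasDerivAt (fun r => κ * (r - s)) κ r := by
          simpa using ((hasDerivAt_id r).sub_const s).const_mul κ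
        exact this.exp
      exact h1.mul (hd r hr)
    · exact ContinuousOn.mul (by fun_prop) hφ
    · intro r hr
      have := mul_le_mul_of_nonneg_left (hle r (ht.trans hr)) (Real.exp_pos (κ * (r - s))).le
      nlinarith
  have hq : Real.exp (-κ) < 1 := by rw [Real.exp_lt_one_iff]; linarith
  have hq0 := Real.exp_pos (-κ)
  have hK0 : 0 ≤ K := by
    refine le_trans ?_ (hK T le_rfl)
    apply intervalIntegral.integral_nonneg (by linarith)
    exact fun r hr => hφ0 r (lt_of_lt_of_le hT hr.1)
  have hn : ∀ n : ℕ, H (T + n) ≤ Real.exp (-κ * n) * H T + K / (1 - Real.exp (-κ)) := by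
    intro n
    induction n with
    | zero =>
      simp only [Nat.cast_zero, add_zero, mul_zero, Real.exp_zero, one_mul]
      have : 0 ≤ K / (1 - Real.exp (-κ)) := div_nonneg hK0 (by linarith)
      linarith
    | succ n ih =>
      have h1 := hone (T + n) (T + (n + 1)) (by linarith [n.cast_nonneg (α := ℝ)])
        (by linarith) (by linarith)
      have h2 : -κ * ((T + ((n:ℝ) + 1)) - (T + n)) = -κ := by ring
      rw [h2] at h1
      have h3 := mul_le_mul_of_nonneg_left ih hq0.le
      have h4 : Real.exp (-κ) * (Real.exp (-κ * n) * H T + K / (1 - Real.exp (-κ))) + K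
          = Real.exp (-κ * ((n:ℝ) + 1)) * H T + K / (1 - Real.exp (-κ)) := by
        have : Real.exp (-κ * ((n:ℝ) + 1)) = Real.exp (-κ) * Real.exp (-κ * n) := by
          rw [← Real.exp_add]; congr 1; ring
        rw [this]
        have h5 : (1 - Real.exp (-κ)) ≠ 0 := by linarith
        field_simp
        ring
      push_cast
      linarith
  intro t ht
  set n := ⌊t - T⌋₊ with hndef
  have hn1 : (n:ℝ) ≤ t - T := Nat.floor_le (by linarith)
  have hn2 : t - T < n + 1 := Nat.lt_floor_add_one _
  have h1 := hone (T + n) t (by linarith [n.cast_nonneg (α := ℝ)]) (by linarith) (by linarith)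
  have h3 := mul_le_mul_of_nonneg_left (hn n) (Real.exp_pos (-κ * (t - (T + n)))).le
  have h4 : Real.exp (-κ * (t - (T + n))) ≤ 1 := by
    rw [Real.exp_le_one_iff]; nlinarith
  have h5 : Real.exp (-κ * (t - T)) = Real.exp (-κ * (t - (T + n))) * Real.exp (-κ * n) := by
    rw [← Real.exp_add]; congr 1; ring
  have h6 : 0 ≤ K / (1 - Real.exp (-κ)) := div_nonneg hK0 (by linarith)
  rw [h5]
  nlinarith

/-! ### The abstract solution data -/

structure Core (a b χ : ℝ) (u ux uxx ut v vx vxx vt B1 B2 : ℝ → ℝ → ℝ) : Prop where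
  hab : a < b
  cu : CO a b u
  cux : CO a b ux
  cuxx : CO a b uxx
  cut : CO a b ut
  cv : CO a b v
  cvx : CO a b vx
  cvxx : CO a b vxx
  cvt : CO a b vt
  cB1 : CO a b B1
  cB2 : CO a b B2
  up : ∀ x ∈ Icc a b, ∀ t : ℝ, 0 < t → 0 < u x t
  vp : ∀ x ∈ Icc a b, ∀ t : ℝ, 0 < t → 0 < v x t
  dux : ∀ x ∈ Icc a b, ∀ t : ℝ, 0 < t → HasDerivAt (fun y => u y t) (ux x t) x
  duxx : ∀ x ∈ Icc a b, ∀ t : ℝ, 0 < t → HasDerivAt (fun y => ux y t) (uxx x t) x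
  dut : ∀ x ∈ Icc a b, ∀ t : ℝ, 0 < t → HasDerivAt (fun s => u x s) (ut x t) t
  dvx : ∀ x ∈ Icc a b, ∀ t : ℝ, 0 < t → HasDerivAt (fun y => v y t) (vx x t) x
  dvxx : ∀ x ∈ Icc a b, ∀ t : ℝ, 0 < t → HasDerivAt (fun y => vx y t) (vxx x t) x
  dvt : ∀ x ∈ Icc a b, ∀ t : ℝ, 0 < t → HasDerivAt (fun s => v x s) (vt x t) t
  ueq : ∀ x ∈ Icc a b, ∀ t : ℝ, 0 < t → ut x t = uxx x t
    - χ * ((ux x t * v x t - u x t * vx x t) / v x t ^ 2 * vx x t + u x t / v x t * vxx x t)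
    - u x t * v x t + B1 x t
  veq : ∀ x ∈ Icc a b, ∀ t : ℝ, 0 < t → vt x t = vxx x t + u x t * v x t - v x t + B2 x t
  ubc : ∀ t : ℝ, 0 < t → ux a t = 0 ∧ ux b t = 0
  vbc : ∀ t : ℝ, 0 < t → vx a t = 0 ∧ vx b t = 0
  B1n : ∀ x t : ℝ, 0 ≤ B1 x t
  B2n : ∀ x t : ℝ, 0 ≤ B2 x t

lemma CO_of_HypB {a b : ℝ} {B : ℝ → ℝ → ℝ} (h : HypB a b B) : CO a b B := by
  obtain ⟨_, _, ϑ, hϑ, hK⟩ := h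
  rintro ⟨x, t⟩ ⟨hx, ht⟩
  have ht : 0 < t := ht
  obtain ⟨C, hC⟩ := hK (Icc a b ×ˢ Icc (t/2) (t+1)) (isCompact_Icc.prod isCompact_Icc)
    (by rintro ⟨y, s⟩ ⟨hy, hs⟩; exact ⟨hy, le_trans (by positivity) hs.1⟩)
  have hmem : (Icc a b ×ˢ Icc (t/2) (t+1)) ∈ 𝓝[Icc a b ×ˢ Ioi 0] (x, t) := by
    rw [nhdsWithin_prod_eq]
    exact Filter.prod_mem_prod self_mem_nhdsWithin (mem_nhdsWithin_of_mem_nhds (nhds_half ht))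
  have hxt : (x, t) ∈ Icc a b ×ˢ Icc (t/2) (t+1) := ⟨hx, by constructor <;> linarith⟩
  unfold ContinuousWithinAt
  rw [tendsto_iff_dist_tendsto_zero]
  have hlim : Tendsto (fun p : ℝ × ℝ => C * dist p (x, t) ^ ϑ) (𝓝[Icc a b ×ˢ Ioi 0] (x, t))
      (𝓝 0) := by
    have h1 : Tendsto (fun p : ℝ × ℝ => dist p (x, t)) (𝓝[Icc a b ×ˢ Ioi 0] (x, t)) (𝓝 0) := by
      have : Tendsto (fun p : ℝ × ℝ => dist p (x, t)) (𝓝 (x, t)) (𝓝 (dist (x, t) (x, t))) :=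
        (Continuous.dist continuous_id continuous_const).tendsto _
      rw [dist_self] at this
      exact this.mono_left nhdsWithin_le_nhds
    have h2 := (h1.rpow_const (p := ϑ) (Or.inr hϑ.1.le)).const_mul C
    rwa [Real.zero_rpow hϑ.1.ne', mul_zero] at h2
  refine squeeze_zero' (Eventually.of_forall fun _ => dist_nonneg) ?_ hlim
  filter_upwards [hmem] with p hp
  rw [Real.dist_eq]
  exact hC p hp (x, t) hxt

lemma core_of_sol {a b χ : ℝ} (hab : a < b) {B1 B2 : ℝ → ℝ → ℝ} (hB1 : HypB a b B1)
    (hB2 : HypB a b B2) {u0 v0 : ℝ → ℝ} {u v : ℝ → ℝ → ℝ}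
    (hsol : CrimeSol a b χ B1 B2 u0 v0 u v ⊤) :
    Core a b χ u (pdx u) (pdx (pdx u)) (pdt u) v (pdx v) (pdx (pdx v)) (pdt v) B1 B2 := by
  have hI : ∀ t : ℝ, 0 < t → t ∈ It' ⊤ := fun t ht => ⟨ht, ENNReal.ofReal_lt_top⟩
  have hI' : It' ⊤ = Ioi 0 := by
    ext t; exact ⟨fun h => h.1, fun h => hI t h⟩
  have hIsub : Ioi 0 ⊆ It ⊤ := fun t ht => ⟨le_of_lt ht, ENNReal.ofReal_lt_top⟩
  have hu21 := hsol.u_cont21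
  have hv21 := hsol.v_cont21
  rw [hI'] at hu21 hv21
  have cu : CO a b u := ContinuousOn.mono hsol.u_cont (prod_mono le_rfl hIsub)
  have cv : CO a b v := ContinuousOn.mono hsol.v_cont (prod_mono le_rfl hIsub)
  have cux : CO a b (pdx u) := hu21.fst
  have cuxx : CO a b (pdx (pdx u)) := hu21.snd.fst
  have cut : CO a b (pdt u) := hu21.snd.snd
  have cvx : CO a b (pdx v) := hv21.fst
  have cvxx : CO a b (pdx (pdx v)) := hv21.snd.fst
  have cvt : CO a b (pdt v) := hv21.snd.snd
  have cB1 := CO_of_HypB hB1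
  have cB2 := CO_of_HypB hB2
  have up : ∀ x ∈ Icc a b, ∀ t : ℝ, 0 < t → 0 < u x t := fun x hx t ht => hsol.u_pos x hx t (hI t ht)
  have vp : ∀ x ∈ Icc a b, ∀ t : ℝ, 0 < t → 0 < v x t := fun x hx t ht => hsol.v_pos x hx t (hI t ht)
  have dux : ∀ x ∈ Icc a b, ∀ t : ℝ, 0 < t → HasDerivAt (fun y => u y t) (pdx u x t) x :=
    fun x hx t ht => (hsol.u_reg x hx t (hI t ht)).1.hasDerivAt
  have dvx : ∀ x ∈ Icc a b, ∀ t : ℝ, 0 < t → HasDerivAt (fun y => v y t) (pdx v x t) x :=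
    fun x hx t ht => (hsol.v_reg x hx t (hI t ht)).1.hasDerivAt
  have dvxx : ∀ x ∈ Icc a b, ∀ t : ℝ, 0 < t →
      HasDerivAt (fun y => pdx v y t) (pdx (pdx v) x t) x :=
    fun x hx t ht => (hsol.v_reg x hx t (hI t ht)).2.1.hasDerivAt
  have hclo : Icc a b ⊆ closure (Ioo a b) := by rw [closure_Ioo hab.ne]
  refine ⟨hab, cu, cux, cuxx, cut, cv, cvx, cvxx, cvt, cB1, cB2, up, vp, dux,
    fun x hx t ht => (hsol.u_reg x hx t (hI t ht)).2.1.hasDerivAt,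
    fun x hx t ht => (hsol.u_reg x hx t (hI t ht)).2.2.hasDerivAt, dvx, dvxx,
    fun x hx t ht => (hsol.v_reg x hx t (hI t ht)).2.2.hasDerivAt, ?_, ?_,
    fun t ht => hsol.u_bc t (hI t ht), fun t ht => hsol.v_bc t (hI t ht), hB1.1, hB2.1⟩
  · intro x hx t ht
    have c1 := cu.slice ht
    have c2 := cux.slice ht
    have c3 := cuxx.slice ht
    have c4 := cv.slice ht
    have c5 := cvx.slice ht
    have c6 := cvxx.slice ht
    have c7 := cB1.slice ht
    have hv0 : ∀ x ∈ Icc a b, v x t ≠ 0 := fun x hx => (vp x hx t ht).ne'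
    have hv2 : ∀ x ∈ Icc a b, v x t ^ 2 ≠ 0 := fun x hx => pow_ne_zero _ (hv0 x hx)
    refine Set.EqOn.of_subset_closure (s := Ioo a b) (t := Icc a b)
      (f := fun x => pdt u x t) (g := fun x => pdx (pdx u) x t
        - χ * ((pdx u x t * v x t - u x t * pdx v x t) / v x t ^ 2 * pdx v x t
          + u x t / v x t * pdx (pdx v) x t) - u x t * v x t + B1 x t)
      ?_ (cut.slice ht) ?_ Ioo_subset_Icc_self hclo hx
    · intro y hy
      have hy' := Ioo_subset_Icc_self hy
      have h := hsol.u_eq y hy t (hI t ht)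
      have h2 : pdx (fun y s => u y s / v y s * pdx v y s) y t
          = (pdx u y t * v y t - u y t * pdx v y t) / v y t ^ 2 * pdx v y t
          + u y t / v y t * pdx (pdx v) y t :=
        (((dux y hy' t ht).div (dvx y hy' t ht) (hv0 y hy')).mul (dvxx y hy' t ht)).deriv
      rw [h2] at h
      exact h
    · exact (((c3.sub (continuousOn_const.mul (((((c2.mul c4).sub (c1.mul c5)).div (c4.pow 2)
        hv2).mul c5).add ((c1.div c4 hv0).mul c6)))).sub (c1.mul c4)).add c7)
  · intro x hx t ht
    refine Set.EqOn.of_subset_closure (s := Ioo a b) (t := Icc a b)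
      (f := fun x => pdt v x t)
      (g := fun x => pdx (pdx v) x t + u x t * v x t - v x t + B2 x t)
      (fun y hy => hsol.v_eq y hy t (hI t ht)) (cvt.slice ht) ?_ Ioo_subset_Icc_self hclo hx
    exact (((cvxx.slice ht).add ((cu.slice ht).mul (cv.slice ht))).sub (cv.slice ht)).add
      (cB2.slice ht)

lemma CO.add {a b : ℝ} {f g : ℝ → ℝ → ℝ} (hf : CO a b f) (hg : CO a b g) :
    CO a b (fun x t => f x t + g x t) := ContinuousOn.add hf hg

lemma CO.sub {a b : ℝ} {f g : ℝ → ℝ → ℝ} (hf : CO a b f) (hg : CO a b g) :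
    CO a b (fun x t => f x t - g x t) := ContinuousOn.sub hf hg

lemma CO.mul {a b : ℝ} {f g : ℝ → ℝ → ℝ} (hf : CO a b f) (hg : CO a b g) :
    CO a b (fun x t => f x t * g x t) := ContinuousOn.mul hf hg

lemma CO.pow {a b : ℝ} {f : ℝ → ℝ → ℝ} (hf : CO a b f) (n : ℕ) :
    CO a b (fun x t => f x t ^ n) := ContinuousOn.pow hf n

lemma CO.const {a b : ℝ} (c : ℝ) : CO a b (fun _ _ => c) := continuousOn_const

lemma CO.div {a b : ℝ} {f g : ℝ → ℝ → ℝ} (hf : CO a b f) (hg : CO a b g)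
    (h : ∀ x ∈ Icc a b, ∀ t : ℝ, 0 < t → 0 < g x t) :
    CO a b (fun x t => f x t / g x t) :=
  ContinuousOn.div hf hg (fun p hp => (h p.1 hp.1 p.2 hp.2).ne')

lemma CO.rpow {a b : ℝ} {g : ℝ → ℝ → ℝ} (hg : CO a b g)
    (h : ∀ x ∈ Icc a b, ∀ t : ℝ, 0 < t → 0 < g x t) (p : ℝ) :
    CO a b (fun x t => g x t ^ p) :=
  ContinuousOn.rpow_const hg (fun q hq => Or.inl (h q.1 hq.1 q.2 hq.2).ne')

section Main

variable {a b χ : ℝ} {u ux uxx ut v vx vxx vt B1 B2 : ℝ → ℝ → ℝ}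

lemma Core.cy (h : Core a b χ u ux uxx ut v vx vxx vt B1 B2) :
    CO a b (fun x t => ux x t / u x t) := h.cux.div h.cu h.up

lemma Core.cw (h : Core a b χ u ux uxx ut v vx vxx vt B1 B2) :
    CO a b (fun x t => vx x t / v x t) := h.cvx.div h.cv h.vp

lemma Core.deriv_u (h : Core a b χ u ux uxx ut v vx vxx vt B1 B2) {t : ℝ} (ht : 0 < t) :
    HasDerivAt (fun s => ∫ x in a..b, u x s) (∫ x in a..b, (B1 x t - u x t * v x t)) t := by
  refine deriv_flux h.hab.le (f := u) (ft := ut)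
    (φ := fun x t => ux x t - χ * (u x t / v x t * vx x t))
    (φx := fun x t => uxx x t - χ * ((ux x t * v x t - u x t * vx x t) / v x t ^ 2 * vx x t
      + u x t / v x t * vxx x t))
    (r := fun x t => B1 x t - u x t * v x t) h.cu h.cut ?_ (h.cB1.sub (h.cu.mul h.cv)) h.dut ?_ ?_
    ?_ ht
  · exact h.cuxx.sub ((CO.const χ).mul ((((h.cux.mul h.cv).sub (h.cu.mul h.cvx)).div (h.cv.pow 2)
      (fun x hx t ht => pow_pos (h.vp x hx t ht) 2)).mul h.cvx |>.add
      ((h.cu.div h.cv h.vp).mul h.cvxx)))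
  · intro x hx t ht
    exact (h.duxx x hx t ht).sub ((((h.dux x hx t ht).div (h.dvx x hx t ht)
      (h.vp x hx t ht).ne').mul (h.dvxx x hx t ht)).const_mul χ)
  · intro t ht
    simp [(h.ubc t ht).1, (h.ubc t ht).2, (h.vbc t ht).1, (h.vbc t ht).2]
  · intro x hx t ht
    rw [h.ueq x hx t ht]; ring

lemma Core.deriv_v (h : Core a b χ u ux uxx ut v vx vxx vt B1 B2) {t : ℝ} (ht : 0 < t) :
    HasDerivAt (fun s => ∫ x in a..b, v x s)
      (∫ x in a..b, (u x t * v x t - v x t + B2 x t)) t := by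
  refine deriv_flux h.hab.le (f := v) (ft := vt) (φ := vx) (φx := vxx)
    (r := fun x t => u x t * v x t - v x t + B2 x t) h.cv h.cvt h.cvxx
    (((h.cu.mul h.cv).sub h.cv).add h.cB2) h.dvt h.dvxx h.vbc ?_ ht
  intro x hx t ht
  rw [h.veq x hx t ht]; ring

lemma Core.deriv_m (h : Core a b χ u ux uxx ut v vx vxx vt B1 B2) (p q : ℝ) {t : ℝ}
    (ht : 0 < t) :
    HasDerivAt (fun s => ∫ x in a..b, u x s ^ p * v x s ^ q)
      (∫ x in a..b, u x t ^ p * v x t ^ q * (p * (1 - p) * (ux x t / u x t) ^ 2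
        - (2 * p * q + p * (1 - p) * χ) * ((ux x t / u x t) * (vx x t / v x t))
        + q * (1 - q + p * χ) * (vx x t / v x t) ^ 2
        - p * v x t + q * u x t - q + p * (B1 x t / u x t) + q * (B2 x t / v x t))) t := by
  have cm : CO a b (fun x t => u x t ^ p * v x t ^ q) := (h.cu.rpow h.up p).mul (h.cv.rpow h.vp q)
  have cy := h.cy
  have cw := h.cw
  have cyx : CO a b (fun x t => (uxx x t * u x t - ux x t * ux x t) / u x t ^ 2) :=
    ((h.cuxx.mul h.cu).sub (h.cux.mul h.cux)).div (h.cu.pow 2)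
      (fun x hx t ht => pow_pos (h.up x hx t ht) 2)
  have cwx : CO a b (fun x t => (vxx x t * v x t - vx x t * vx x t) / v x t ^ 2) :=
    ((h.cvxx.mul h.cv).sub (h.cvx.mul h.cvx)).div (h.cv.pow 2)
      (fun x hx t ht => pow_pos (h.vp x hx t ht) 2)
  have hm : ∀ (f g : ℝ → ℝ) (f' g' z : ℝ), 0 < f z → 0 < g z → HasDerivAt f f' z →
      HasDerivAt g g' z → HasDerivAt (fun z => f z ^ p * g z ^ q)
        (f z ^ p * g z ^ q * (p * (f' / f z) + q * (g' / g z))) z := by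
    intro f g f' g' z hf hg hf' hg'
    have h1 := (hf'.rpow_const (p := p) (Or.inl hf.ne')).mul
      (hg'.rpow_const (p := q) (Or.inl hg.ne'))
    refine h1.congr_deriv ?_
    rw [Real.rpow_sub_one hf.ne', Real.rpow_sub_one hg.ne']
    field_simp
  refine deriv_flux h.hab.le (f := fun x t => u x t ^ p * v x t ^ q)
    (ft := fun x t => u x t ^ p * v x t ^ q * (p * (ut x t / u x t) + q * (vt x t / v x t)))
    (φ := fun x t => u x t ^ p * v x t ^ q *
      (p * (ux x t / u x t - χ * (vx x t / v x t)) + q * (vx x t / v x t)))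
    (φx := fun x t => u x t ^ p * v x t ^ q * (p * (ux x t / u x t) + q * (vx x t / v x t)) *
      (p * (ux x t / u x t - χ * (vx x t / v x t)) + q * (vx x t / v x t)) +
      u x t ^ p * v x t ^ q * (p * ((uxx x t * u x t - ux x t * ux x t) / u x t ^ 2
        - χ * ((vxx x t * v x t - vx x t * vx x t) / v x t ^ 2))
        + q * ((vxx x t * v x t - vx x t * vx x t) / v x t ^ 2)))
    (r := fun x t => u x t ^ p * v x t ^ q * (p * (1 - p) * (ux x t / u x t) ^ 2
        - (2 * p * q + p * (1 - p) * χ) * ((ux x t / u x t) * (vx x t / v x t))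
        + q * (1 - q + p * χ) * (vx x t / v x t) ^ 2
        - p * v x t + q * u x t - q + p * (B1 x t / u x t) + q * (B2 x t / v x t)))
    cm ?_ ?_ ?_ ?_ ?_ ?_ ?_ ht
  · exact cm.mul (((CO.const p).mul (h.cut.div h.cu h.up)).add
      ((CO.const q).mul (h.cvt.div h.cv h.vp)))
  · exact ((cm.mul (((CO.const p).mul cy).add ((CO.const q).mul cw))).mul
      (((CO.const p).mul (cy.sub ((CO.const χ).mul cw))).add ((CO.const q).mul cw))).add
      (cm.mul (((CO.const p).mul (cyx.sub ((CO.const χ).mul cwx))).add ((CO.const q).mul cwx)))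
  · exact cm.mul ((((((((CO.const _).mul (cy.pow 2)).sub ((CO.const _).mul (cy.mul cw))).add
      ((CO.const _).mul (cw.pow 2))).sub ((CO.const p).mul h.cv)).add ((CO.const q).mul h.cu)).sub
      (CO.const q)).add ((CO.const p).mul (h.cB1.div h.cu h.up)) |>.add
      ((CO.const q).mul (h.cB2.div h.cv h.vp)))
  · intro x hx t ht
    exact hm (fun s => u x s) (fun s => v x s) _ _ t (h.up x hx t ht) (h.vp x hx t ht)
      (h.dut x hx t ht) (h.dvt x hx t ht)
  · intro x hx t ht
    have d1 := hm (fun y => u y t) (fun y => v y t) _ _ x (h.up x hx t ht) (h.vp x hx t ht)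
      (h.dux x hx t ht) (h.dvx x hx t ht)
    have d2 := (h.duxx x hx t ht).div (h.dux x hx t ht) (h.up x hx t ht).ne'
    have d3 := (h.dvxx x hx t ht).div (h.dvx x hx t ht) (h.vp x hx t ht).ne'
    exact d1.mul (((d2.sub (d3.const_mul χ)).const_mul p).add (d3.const_mul q))
  · intro t ht
    simp [(h.ubc t ht).1, (h.ubc t ht).2, (h.vbc t ht).1, (h.vbc t ht).2]
  · intro x hx t ht
    rw [h.ueq x hx t ht, h.veq x hx t ht]
    have hu := (h.up x hx t ht).ne'
    have hv := (h.vp x hx t ht).ne'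
    generalize u x t ^ p * v x t ^ q = m
    field_simp
    ring

lemma CO.int_mono (hab : a ≤ b) {f g : ℝ → ℝ → ℝ} (hf : CO a b f) (hg : CO a b g) {t : ℝ}
    (ht : 0 < t) (hle : ∀ x ∈ Icc a b, f x t ≤ g x t) :
    ∫ x in a..b, f x t ≤ ∫ x in a..b, g x t :=
  intervalIntegral.integral_mono_on hab (hf.ii hab ht) (hg.ii hab ht) hle

lemma int_nonneg' (hab : a ≤ b) {f : ℝ → ℝ} (hf : ∀ x ∈ Icc a b, 0 ≤ f x) :
    0 ≤ ∫ x in a..b, f x := intervalIntegral.integral_nonneg hab hf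

lemma rpow_le_one_add {x p : ℝ} (hx : 0 < x) (hp0 : 0 ≤ p) (hp : p ≤ 1) : x ^ p ≤ 1 + x := by
  rcases le_total x 1 with h | h
  · have := Real.rpow_le_one hx.le h hp0; linarith
  · have := Real.rpow_le_rpow_of_exponent_le h hp
    rw [Real.rpow_one] at this; linarith

lemma rpow_mul_le {x y p q : ℝ} (hx : 0 < x) (hy : 0 < y) (hp : 0 ≤ p) (hq : 0 ≤ q)
    (hpq : p + q ≤ 1) : x ^ p * y ^ q ≤ 1 + x + y := by
  have h1 : x ^ p ≤ (x + y) ^ p := Real.rpow_le_rpow hx.le (by linarith) hp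
  have h2 : y ^ q ≤ (x + y) ^ q := Real.rpow_le_rpow hy.le (by linarith) hq
  have h3 : x ^ p * y ^ q ≤ (x + y) ^ p * (x + y) ^ q :=
    mul_le_mul h1 h2 (Real.rpow_nonneg hy.le _) (Real.rpow_nonneg (by linarith) _)
  rw [← Real.rpow_add (by linarith)] at h3
  have := rpow_le_one_add (show 0 < x + y by linarith) (add_nonneg hp hq) hpq
  linarith

lemma Core.int_1uv (h : Core a b χ u ux uxx ut v vx vxx vt B1 B2) {t : ℝ} (ht : 0 < t) :
    ∫ x in a..b, (1 + u x t + v x t)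
      = (b - a) + (∫ x in a..b, u x t) + ∫ x in a..b, v x t := by
  rw [intervalIntegral.integral_add (((CO.const 1).add h.cu).ii h.hab.le ht) (h.cv.ii h.hab.le ht),
    intervalIntegral.integral_add ((CO.const 1).ii h.hab.le ht) (h.cu.ii h.hab.le ht),
    intervalIntegral.integral_const, smul_eq_mul, mul_one]

lemma Core.mass_u (h : Core a b χ u ux uxx ut v vx vxx vt B1 B2) {M0 : ℝ}
    (hM0 : ∀ T : ℝ, 1 ≤ T → ∫ t in (1:ℝ)..T, ∫ x in a..b, B1 x t ≤ M0) :
    ∃ M : ℝ, 0 ≤ M ∧ (∀ t : ℝ, 1 ≤ t → ∫ x in a..b, u x t ≤ M) ∧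
      (∀ T : ℝ, 1 ≤ T → ∫ t in (1:ℝ)..T, ∫ x in a..b, u x t * v x t ≤ M) := by
  have hu0 : ∀ t : ℝ, 0 < t → 0 ≤ ∫ x in a..b, u x t := fun t ht =>
    int_nonneg' h.hab.le fun x hx => (h.up x hx t ht).le
  have hη0 : ∀ t : ℝ, 0 < t → 0 ≤ ∫ x in a..b, u x t * v x t := fun t ht =>
    int_nonneg' h.hab.le fun x hx => (mul_pos (h.up x hx t ht) (h.vp x hx t ht)).le
  have key : ∀ T : ℝ, 1 ≤ T → (∫ x in a..b, u x T) +
      ∫ t in (1:ℝ)..T, ∫ x in a..b, u x t * v x t ≤ (∫ x in a..b, u x 1) + M0 := by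
    intro T hT
    have cβ := h.cB1.cont_int h.hab.le
    have cη := (h.cu.mul h.cv).cont_int h.hab.le
    have h1 := sub_le_int (H := fun s => ∫ x in a..b, u x s)
      (φ := fun s => (∫ x in a..b, B1 x s) - ∫ x in a..b, u x s * v x s)
      (fun t ht => h.deriv_u ht) (cβ.sub cη) one_pos hT (fun r hr => by
        rw [intervalIntegral.integral_sub (h.cB1.ii h.hab.le (by linarith))
          ((h.cu.mul h.cv).ii h.hab.le (by linarith))])
    rw [intervalIntegral.integral_sub (ii_of_pos cβ one_pos hT) (ii_of_pos cη one_pos hT)] at h1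
    have := hM0 T hT
    linarith
  have hM00 : 0 ≤ M0 := by simpa using hM0 1 le_rfl
  refine ⟨(∫ x in a..b, u x 1) + M0, add_nonneg (hu0 1 one_pos) hM00, fun T hT => ?_,
    fun T hT => ?_⟩
  · have h1 := key T hT
    have h2 : 0 ≤ ∫ t in (1:ℝ)..T, ∫ x in a..b, u x t * v x t :=
      intervalIntegral.integral_nonneg hT fun t ht => hη0 t (by linarith [ht.1])
    linarith
  · have h1 := key T hT
    have h2 := hu0 T (by linarith)
    linarith

lemma Core.mass_v (h : Core a b χ u ux uxx ut v vx vxx vt B1 B2) {M N : ℝ}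
    (hM : ∀ t : ℝ, 1 ≤ t → ∫ x in a..b, u x t ≤ M)
    (hN1 : ∀ x t : ℝ, B1 x t ≤ N) (hN2 : ∀ x t : ℝ, B2 x t ≤ N) :
    ∃ K : ℝ, 0 ≤ K ∧ ∀ t : ℝ, 1 ≤ t → ∫ x in a..b, v x t ≤ K := by
  have hL : 0 < b - a := sub_pos.2 h.hab
  have hN0 : 0 ≤ N := (h.B1n 0 0).trans (hN1 0 0)
  have hu0 : ∀ t : ℝ, 0 < t → 0 ≤ ∫ x in a..b, u x t := fun t ht =>
    int_nonneg' h.hab.le fun x hx => (h.up x hx t ht).le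
  have hv0 : ∀ t : ℝ, 0 < t → 0 ≤ ∫ x in a..b, v x t := fun t ht =>
    int_nonneg' h.hab.le fun x hx => (h.vp x hx t ht).le
  have hM0 : 0 ≤ M := (hu0 1 one_pos).trans (hM 1 le_rfl)
  have hB : ∀ B : ℝ → ℝ → ℝ, CO a b B → (∀ x t : ℝ, B x t ≤ N) → ∀ t : ℝ, 0 < t →
      ∫ x in a..b, B x t ≤ N * (b - a) := by
    intro B cB hB t ht
    have := cB.int_mono h.hab.le (CO.const N) ht (fun x _ => hB x t)
    rw [intervalIntegral.integral_const, smul_eq_mul] at this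
    linarith
  set φ : ℝ := M + 2 * (N * (b - a)) with hφ
  have hφ0 : 0 ≤ φ := by positivity
  have hode := ode_bound (H := fun s => (∫ x in a..b, u x s) + ∫ x in a..b, v x s) (κ := 1)
    (K := φ) (T := 1) (φ := fun _ => φ)
    one_pos one_pos (fun t ht => (h.deriv_u ht).add (h.deriv_v ht)) continuousOn_const
    (fun _ _ => hφ0) ?_ ?_
  · refine ⟨((∫ x in a..b, u x 1) + ∫ x in a..b, v x 1) + (φ / (1 - Real.exp (-1)) + φ), ?_, ?_⟩
    · have h1 := hu0 1 one_pos
      have h2 := hv0 1 one_pos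
      have h3 : Real.exp (-1) < 1 := by rw [Real.exp_lt_one_iff]; norm_num
      have : 0 ≤ φ / (1 - Real.exp (-1)) := div_nonneg hφ0 (by linarith)
      linarith
    · intro t ht
      have h1 := hode t ht
      have h2 := hu0 t (by linarith)
      have h3 : Real.exp (-1 * (t - 1)) ≤ 1 := by rw [Real.exp_le_one_iff]; linarith
      have h4 := add_nonneg (hu0 1 one_pos) (hv0 1 one_pos)
      have h5 := mul_le_mul_of_nonneg_right h3 h4
      linarith
  · intro t ht
    have ht0 : 0 < t := by linarith
    rw [intervalIntegral.integral_sub (h.cB1.ii h.hab.le ht0) ((h.cu.mul h.cv).ii h.hab.le ht0),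
      intervalIntegral.integral_add (((h.cu.mul h.cv).sub h.cv).ii h.hab.le ht0)
        (h.cB2.ii h.hab.le ht0),
      intervalIntegral.integral_sub ((h.cu.mul h.cv).ii h.hab.le ht0) (h.cv.ii h.hab.le ht0)]
    have h1 := hB B1 h.cB1 hN1 t ht0
    have h2 := hB B2 h.cB2 hN2 t ht0
    have h3 := hM t ht
    linarith
  · intro t ht
    rw [intervalIntegral.integral_const, smul_eq_mul]
    linarith

lemma Core.est_D (h : Core a b χ u ux uxx ut v vx vxx vt B1 B2) {M : ℝ}
    (hu : ∀ t : ℝ, 1 ≤ t → ∫ x in a..b, u x t ≤ M)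
    (hv : ∀ t : ℝ, 1 ≤ t → ∫ x in a..b, v x t ≤ M) :
    ∃ K : ℝ, ∀ t : ℝ, 1 ≤ t → ∫ s in t..(t+1), ∫ x in a..b,
      u x s ^ (0:ℝ) * v x s ^ (1/2:ℝ) * (vx x s / v x s) ^ 2 ≤ K := by
  have cm : CO a b (fun x t => u x t ^ (0:ℝ) * v x t ^ (1/2:ℝ)) :=
    (h.cu.rpow h.up _).mul (h.cv.rpow h.vp _)
  have cD := cm.mul (h.cw.pow 2)
  have cDi := cD.cont_int h.hab.le
  have hm0 : ∀ x ∈ Icc a b, ∀ t : ℝ, 0 < t → 0 < u x t ^ (0:ℝ) * v x t ^ (1/2:ℝ) :=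
    fun x hx t ht => mul_pos (Real.rpow_pos_of_pos (h.up x hx t ht) _)
      (Real.rpow_pos_of_pos (h.vp x hx t ht) _)
  have hm1 : ∀ x ∈ Icc a b, ∀ t : ℝ, 0 < t →
      u x t ^ (0:ℝ) * v x t ^ (1/2:ℝ) ≤ 1 + u x t + v x t :=
    fun x hx t ht => rpow_mul_le (h.up x hx t ht) (h.vp x hx t ht) (by norm_num) (by norm_num)
      (by norm_num)
  set C := (b - a) + M + M with hC
  have hmassInt : ∀ t : ℝ, 1 ≤ t → ∫ x in a..b, (1 + u x t + v x t) ≤ C := by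
    intro t ht
    rw [h.int_1uv (by linarith)]
    linarith [hu t ht, hv t ht]
  have hP : ∀ t : ℝ, 1 ≤ t → ∫ x in a..b, u x t ^ (0:ℝ) * v x t ^ (1/2:ℝ) ≤ C := by
    intro t ht
    exact (cm.int_mono h.hab.le (((CO.const 1).add h.cu).add h.cv) (by linarith)
      (fun x hx => hm1 x hx t (by linarith))).trans (hmassInt t ht)
  refine ⟨8 * C, fun t ht => ?_⟩
  have ht0 : 0 < t := by linarith
  have h1 := sub_le_int (H := fun s => -∫ x in a..b, u x s ^ (0:ℝ) * v x s ^ (1/2:ℝ))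
    (φ := fun s => C - (1/4) * ∫ x in a..b,
      u x s ^ (0:ℝ) * v x s ^ (1/2:ℝ) * (vx x s / v x s) ^ 2)
    (fun t ht => (h.deriv_m 0 (1/2) ht).neg) (continuousOn_const.sub (continuousOn_const.mul cDi))
    ht0 (show t ≤ t + 1 by linarith) ?_
  · rw [intervalIntegral.integral_sub intervalIntegrable_const
      ((ii_of_pos cDi ht0 (by linarith : t ≤ t + 1)).const_mul _),
      intervalIntegral.integral_const, intervalIntegral.integral_const_mul, smul_eq_mul] at h1
    have h2 := hP (t+1) (by linarith)
    have h3 : 0 ≤ ∫ x in a..b, u x t ^ (0:ℝ) * v x t ^ (1/2:ℝ) :=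
      int_nonneg' h.hab.le fun x hx => (hm0 x hx t ht0).le
    have h4 : 0 ≤ ∫ x in a..b, u x (t+1) ^ (0:ℝ) * v x (t+1) ^ (1/2:ℝ) :=
      int_nonneg' h.hab.le fun x hx => (hm0 x hx (t+1) (by linarith)).le
    linarith
  · intro s hs
    have hs1 : 1 ≤ s := by linarith
    have hs0 : 0 < s := by linarith
    have h2 := hmassInt s hs1
    have h3 : (1/4) * (∫ x in a..b, u x s ^ (0:ℝ) * v x s ^ (1/2:ℝ) * (vx x s / v x s) ^ 2)
        - (∫ x in a..b, (1 + u x s + v x s)) ≤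
        ∫ x in a..b, u x s ^ (0:ℝ) * v x s ^ (1/2:ℝ) * (0 * (1 - 0) * (ux x s / u x s) ^ 2
        - (2 * 0 * (1/2) + 0 * (1 - 0) * χ) * ((ux x s / u x s) * (vx x s / v x s))
        + (1/2) * (1 - (1/2) + 0 * χ) * (vx x s / v x s) ^ 2
        - 0 * v x s + (1/2) * u x s - (1/2) + 0 * (B1 x s / u x s) + (1/2) * (B2 x s / v x s)) := by
      rw [← intervalIntegral.integral_const_mul, ← intervalIntegral.integral_sub
        (((CO.const _).mul cD).ii h.hab.le hs0)
        ((((CO.const 1).add h.cu).add h.cv).ii h.hab.le hs0)]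
      apply intervalIntegral.integral_mono_on h.hab.le
        ((((CO.const _).mul cD).sub (((CO.const 1).add h.cu).add h.cv)).ii h.hab.le hs0)
      · have cy := h.cy
        have cw := h.cw
        exact (cm.mul ((((((((CO.const _).mul (cy.pow 2)).sub ((CO.const _).mul (cy.mul cw))).add
          ((CO.const _).mul (cw.pow 2))).sub ((CO.const _).mul h.cv)).add
          ((CO.const _).mul h.cu)).sub
          (CO.const _)).add ((CO.const _).mul (h.cB1.div h.cu h.up)) |>.add
          ((CO.const _).mul (h.cB2.div h.cv h.vp)))).ii h.hab.le hs0
      · intro x hx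
        have e1 := hm0 x hx s hs0
        have e2 := hm1 x hx s hs0
        have e3 := mul_pos e1 (h.up x hx s hs0)
        have e4 := mul_nonneg e1.le (div_nonneg (h.B2n x s) (h.vp x hx s hs0).le)
        nlinarith
    linarith

lemma Core.dx_m (h : Core a b χ u ux uxx ut v vx vxx vt B1 B2) (p q : ℝ) {t : ℝ}
    (ht : 0 < t) {x : ℝ} (hx : x ∈ Icc a b) :
    HasDerivAt (fun y => u y t ^ p * v y t ^ q)
      (u x t ^ p * v x t ^ q * (p * (ux x t / u x t) + q * (vx x t / v x t))) x := by
  have hu := h.up x hx t ht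
  have hv := h.vp x hx t ht
  have h1 := ((h.dux x hx t ht).rpow_const (p := p) (Or.inl hu.ne')).mul
    ((h.dvx x hx t ht).rpow_const (p := q) (Or.inl hv.ne'))
  refine h1.congr_deriv ?_
  rw [Real.rpow_sub_one hu.ne', Real.rpow_sub_one hv.ne']
  field_simp

lemma Core.cm (h : Core a b χ u ux uxx ut v vx vxx vt B1 B2) (p q : ℝ) :
    CO a b (fun x t => u x t ^ p * v x t ^ q) :=
  (h.cu.rpow h.up _).mul (h.cv.rpow h.vp _)

lemma Core.mpos (h : Core a b χ u ux uxx ut v vx vxx vt B1 B2) (p q : ℝ) :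
    ∀ x ∈ Icc a b, ∀ t : ℝ, 0 < t → 0 < u x t ^ p * v x t ^ q :=
  fun x hx t ht => mul_pos (Real.rpow_pos_of_pos (h.up x hx t ht) _)
      (Real.rpow_pos_of_pos (h.vp x hx t ht) _)

lemma Core.int_m_le (h : Core a b χ u ux uxx ut v vx vxx vt B1 B2) {M : ℝ}
    (hu : ∀ t : ℝ, 1 ≤ t → ∫ x in a..b, u x t ≤ M)
    (hv : ∀ t : ℝ, 1 ≤ t → ∫ x in a..b, v x t ≤ M) {p q : ℝ} (hp : 0 ≤ p) (hq : 0 ≤ q)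
    (hpq : p + q ≤ 1) {t : ℝ} (ht : 1 ≤ t) :
    ∫ x in a..b, u x t ^ p * v x t ^ q ≤ (b - a) + M + M := by
  have ht0 : 0 < t := by linarith
  have h1 := (h.cm p q).int_mono h.hab.le (((CO.const 1).add h.cu).add h.cv) ht0
      (fun x hx => rpow_mul_le (h.up x hx t ht0) (h.vp x hx t ht0) hp hq hpq)
  rw [h.int_1uv ht0] at h1
  linarith [hu t ht, hv t ht]

lemma Core.vhalf_sup (h : Core a b χ u ux uxx ut v vx vxx vt B1 B2) {M : ℝ}
    (hu : ∀ t : ℝ, 1 ≤ t → ∫ x in a..b, u x t ≤ M)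
    (hv : ∀ t : ℝ, 1 ≤ t → ∫ x in a..b, v x t ≤ M) :
    ∃ C : ℝ, ∀ t : ℝ, 1 ≤ t → ∀ x ∈ Icc a b, u x t ^ (0:ℝ) * v x t ^ (1/2:ℝ) ≤
      C + ∫ x in a..b, u x t ^ (0:ℝ) * v x t ^ (1/2:ℝ) * (vx x t / v x t) ^ 2 := by
  refine ⟨(1 / (b - a)) * ((b - a) + M + M) + ((b - a) + M + M), fun t ht x hx => ?_⟩
  have ht0 : 0 < t := by linarith
  have hL : 0 < b - a := sub_pos.2 h.hab
  have cm := h.cm 0 (1/2)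
  have c1 := cm.mul (((CO.const 0).mul h.cy).add ((CO.const (1/2)).mul h.cw))
  have c2 := cm.mul (h.cw.pow 2)
  have h1 := sup_bound h.hab (fun x hx => h.dx_m 0 (1/2) ht0 hx) (c1.slice ht0)
    ((cm.add c2).slice ht0) (fun x hx => ?_) hx
  · rw [intervalIntegral.integral_add (cm.ii h.hab.le ht0) (c2.ii h.hab.le ht0)] at h1
    have h2 := h.int_m_le hu hv (p := 0) (q := 1/2) (by norm_num) (by norm_num) (by norm_num) ht
    have h3 := mul_le_mul_of_nonneg_left h2 (show 0 ≤ 1 / (b - a) by positivity)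
    linarith
  · have hm := h.mpos 0 (1/2) x hx t ht0
    rw [abs_mul, abs_of_pos hm]
    have : |0 * (ux x t / u x t) + 1 / 2 * (vx x t / v x t)| ≤ 1 + (vx x t / v x t) ^ 2 := by
      rw [abs_le]; constructor <;> nlinarith [sq_nonneg (vx x t / v x t - 1), sq_nonneg (vx x t / v x t + 1)]
    nlinarith [mul_le_mul_of_nonneg_left this hm.le]

lemma Core.est_J (h : Core a b χ u ux uxx ut v vx vxx vt B1 B2) {M c : ℝ} (hc : 0 < c)
    (hform : ∀ y w : ℝ, c * (y ^ 2 + w ^ 2) ≤ (1/5) * (1 - (1/5)) * y ^ 2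
        - (2 * (1/5) * (2/5) + (1/5) * (1 - (1/5)) * χ) * (y * w)
        + (2/5) * (1 - (2/5) + (1/5) * χ) * w ^ 2)
    (hu : ∀ t : ℝ, 1 ≤ t → ∫ x in a..b, u x t ≤ M)
    (hv : ∀ t : ℝ, 1 ≤ t → ∫ x in a..b, v x t ≤ M)
    (huv : ∀ T : ℝ, 1 ≤ T → ∫ t in (1:ℝ)..T, ∫ x in a..b, u x t * v x t ≤ M) :
    ∃ K : ℝ, ∀ t : ℝ, 1 ≤ t → ∫ s in t..(t+1), ∫ x in a..b,
      u x s ^ (1/5:ℝ) * v x s ^ (2/5:ℝ) * ((ux x s / u x s) ^ 2 + (vx x s / v x s) ^ 2) ≤ K := by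
  obtain ⟨KD, hKD⟩ := h.est_D hu hv
  obtain ⟨C1, hC1⟩ := h.vhalf_sup hu hv
  have cm0 := h.cm 0 (1/2)
  have cD := (cm0.mul (h.cw.pow 2)).cont_int h.hab.le
  have cη := (h.cu.mul h.cv).cont_int h.hab.le
  have cm := h.cm (1/5) (2/5)
  have cJ0 := cm.mul ((h.cy.pow 2).add (h.cw.pow 2))
  have cJ := cJ0.cont_int h.hab.le
  set D : ℝ → ℝ := fun s => ∫ x in a..b,
    u x s ^ (0:ℝ) * v x s ^ (1/2:ℝ) * (vx x s / v x s) ^ 2 with hD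
  set J : ℝ → ℝ := fun s => ∫ x in a..b,
      u x s ^ (1/5:ℝ) * v x s ^ (2/5:ℝ) * ((ux x s / u x s) ^ 2 + (vx x s / v x s) ^ 2) with hJ
  set η : ℝ → ℝ := fun s => ∫ x in a..b, u x s * v x s with hη
  have hη0 : ∀ t : ℝ, 0 < t → 0 ≤ η t := fun t ht =>
    int_nonneg' h.hab.le fun x hx => (mul_pos (h.up x hx t ht) (h.vp x hx t ht)).le
  have hD0 : ∀ t : ℝ, 0 < t → 0 ≤ D t := fun t ht =>
    int_nonneg' h.hab.le fun x hx => mul_nonneg (h.mpos _ _ x hx t ht).le (sq_nonneg _)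
  have hM0 : 0 ≤ M := le_trans
    (int_nonneg' h.hab.le fun x hx => (h.up x hx 1 one_pos).le) (hu 1 le_rfl)
  set Cm := (b - a) + M + M with hCm
  set C2 := |C1| with hC2
  have hP := fun t ht => h.int_m_le hu hv (p := 1/5) (q := 2/5) (by norm_num) (by norm_num)
    (by norm_num) (t := t) ht
  refine ⟨(1/c) * (Cm + (M + M * (C2 + KD) + Cm)), fun t ht => ?_⟩
  have ht0 : 0 < t := by linarith
  have htt : t ≤ t + 1 := by linarith
  have h1 := sub_le_int (H := fun s => -∫ x in a..b, u x s ^ (1/5:ℝ) * v x s ^ (2/5:ℝ))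
    (φ := fun s => η s + M * (C2 + D s) + Cm - c * J s)
    (fun t ht => (h.deriv_m (1/5) (2/5) ht).neg)
    (((cη.add (continuousOn_const.mul (continuousOn_const.add cD))).add continuousOn_const).sub
      (continuousOn_const.mul cJ))
    ht0 htt ?_
  · have iη := ii_of_pos cη ht0 htt
    have iD := ii_of_pos cD ht0 htt
    have iJ := ii_of_pos cJ ht0 htt
    have iCD : IntervalIntegrable (fun s => M * (C2 + D s)) volume t (t+1) :=
      (intervalIntegrable_const.add iD).const_mul _
    rw [intervalIntegral.integral_sub ((iη.add iCD).add intervalIntegrable_const)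
      (iJ.const_mul _), intervalIntegral.integral_add (iη.add iCD) intervalIntegrable_const,
      intervalIntegral.integral_add iη iCD,
      intervalIntegral.integral_const, intervalIntegral.integral_const_mul,
      intervalIntegral.integral_const_mul, intervalIntegral.integral_add
      intervalIntegrable_const iD, intervalIntegral.integral_const, smul_eq_mul, smul_eq_mul] at h1
    have h2 := hP (t+1) (by linarith)
    have h3 : 0 ≤ ∫ x in a..b, u x t ^ (1/5:ℝ) * v x t ^ (2/5:ℝ) :=
      int_nonneg' h.hab.le fun x hx => (h.mpos _ _ x hx t ht0).le
    have h4 : ∫ s in t..(t+1), η s ≤ M := by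
      have e1 := huv (t+1) (by linarith)
      rw [← intervalIntegral.integral_add_adjacent_intervals
        (ii_of_pos cη one_pos ht) iη] at e1
      have e2 : 0 ≤ ∫ s in (1:ℝ)..t, η s :=
        intervalIntegral.integral_nonneg ht fun s hs => hη0 s (by linarith [hs.1])
      linarith
    have h5 := mul_le_mul_of_nonneg_left (hKD t ht) hM0
    have h6 : c * (∫ s in t..(t+1), J s) ≤ Cm + (M + M * (C2 + KD) + Cm) := by
      linarith
    rw [one_div, inv_mul_eq_div, le_div_iff₀ hc]
    linarith
  · intro s hs
    have hs1 : 1 ≤ s := by linarith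
    have hs0 : 0 < s := by linarith
    have hDs := hD0 s hs0
    have hvint : ∫ x in a..b, (C2 + D s) * v x s ≤ M * (C2 + D s) := by
      rw [intervalIntegral.integral_const_mul, mul_comm]
      exact mul_le_mul_of_nonneg_right (hv s hs1) (by positivity)
    have cR := (((h.cu.mul h.cv).add ((CO.const (C2 + D s)).mul h.cv)).add cm)
    have h3 : c * J s
        - (∫ x in a..b, (u x s * v x s + (C2 + D s) * v x s + u x s ^ (1/5:ℝ) * v x s ^ (2/5:ℝ))) ≤
        ∫ x in a..b, u x s ^ (1/5:ℝ) * v x s ^ (2/5:ℝ) *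
        ((1/5) * (1 - (1/5)) * (ux x s / u x s) ^ 2
        - (2 * (1/5) * (2/5) + (1/5) * (1 - (1/5)) * χ) * ((ux x s / u x s) * (vx x s / v x s))
        + (2/5) * (1 - (2/5) + (1/5) * χ) * (vx x s / v x s) ^ 2
        - (1/5) * v x s + (2/5) * u x s - (2/5) + (1/5) * (B1 x s / u x s)
        + (2/5) * (B2 x s / v x s)) := by
      rw [hJ, ← intervalIntegral.integral_const_mul, ← intervalIntegral.integral_sub
        (((CO.const _).mul cJ0).ii h.hab.le hs0)
        (cR.ii h.hab.le hs0)]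
      apply intervalIntegral.integral_mono_on h.hab.le
        ((((CO.const _).mul cJ0).sub cR).ii h.hab.le hs0)
      · have cy := h.cy
        have cw := h.cw
        exact (cm.mul ((((((((CO.const _).mul (cy.pow 2)).sub ((CO.const _).mul (cy.mul cw))).add
          ((CO.const _).mul (cw.pow 2))).sub ((CO.const _).mul h.cv)).add
          ((CO.const _).mul h.cu)).sub
          (CO.const _)).add ((CO.const _).mul (h.cB1.div h.cu h.up)) |>.add
          ((CO.const _).mul (h.cB2.div h.cv h.vp)))).ii h.hab.le hs0
      · intro x hx
        have up := h.up x hx s hs0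
        have vp := h.vp x hx s hs0
        have e1 := h.mpos (1/5) (2/5) x hx s hs0
        have e2 : u x s ^ (1/5:ℝ) * v x s ^ (2/5:ℝ) ≤ u x s + (C2 + D s) := by
          have g1 := Real.geom_mean_le_arith_mean2_weighted (w₁ := 1/5) (w₂ := 4/5)
            (p₁ := u x s) (p₂ := v x s ^ (1/2:ℝ)) (by norm_num) (by norm_num) up.le
            (Real.rpow_nonneg vp.le _) (by norm_num)
          rw [← Real.rpow_mul vp.le] at g1
          have g2 := hC1 s hs1 x hx
          rw [Real.rpow_zero, one_mul] at g2
          have g3 : v x s ^ (1/2:ℝ) ≤ C2 + D s := g2.trans (by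
            have := le_abs_self C1
            simp only [hD, hC2]
            linarith)
          have g4 : (1/2 * (4/5) : ℝ) = 2/5 := by norm_num
          rw [g4] at g1
          have := Real.rpow_nonneg vp.le (1/2:ℝ)
          linarith
        have e3 := mul_pos e1 up
        have e4 := mul_nonneg e1.le (div_nonneg (h.B1n x s) up.le)
        have e5 := mul_nonneg e1.le (div_nonneg (h.B2n x s) vp.le)
        have e6 := mul_le_mul_of_nonneg_left (hform (ux x s / u x s) (vx x s / v x s)) e1.le
        have e7 := mul_le_mul_of_nonneg_right e2 vp.le
        have e8 := mul_pos e1 vp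
        nlinarith
    rw [intervalIntegral.integral_add
      (((h.cu.mul h.cv).add ((CO.const (C2 + D s)).mul h.cv)).ii h.hab.le hs0)
      (cm.ii h.hab.le hs0), intervalIntegral.integral_add ((h.cu.mul h.cv).ii h.hab.le hs0)
      (((CO.const (C2 + D s)).mul h.cv).ii h.hab.le hs0)] at h3
    have h4 := hP s hs1
    have h5 : η s = ∫ x in a..b, u x s * v x s := rfl
    linarith

lemma Core.k_sup (h : Core a b χ u ux uxx ut v vx vxx vt B1 B2) {M : ℝ}
    (hu : ∀ t : ℝ, 1 ≤ t → ∫ x in a..b, u x t ≤ M)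
    (hv : ∀ t : ℝ, 1 ≤ t → ∫ x in a..b, v x t ≤ M) :
    ∃ K : ℝ, 0 ≤ K ∧ ∀ t : ℝ, 1 ≤ t → ∀ x ∈ Icc a b, (u x t ^ (3/5:ℝ) * v x t ^ (1/5:ℝ)) ^ 2 ≤
      K * (1 + ∫ x in a..b, u x t ^ (1/5:ℝ) * v x t ^ (2/5:ℝ) *
        ((ux x t / u x t) ^ 2 + (vx x t / v x t) ^ 2)) := by
  have hL : 0 < b - a := sub_pos.2 h.hab
  have hM0 : 0 ≤ M := le_trans
    (int_nonneg' h.hab.le fun x hx => (h.up x hx 1 one_pos).le) (hu 1 le_rfl)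
  set C0 := (1 / (b - a)) * ((b - a) + M + M) + M + 1 with hC0
  have hC00 : 0 ≤ C0 := by positivity
  refine ⟨C0 ^ 2, by positivity, fun t ht x hx => ?_⟩
  have ht0 : 0 < t := by linarith
  have cm := h.cm (1/5) (2/5)
  have ck := h.cm (3/5) (1/5)
  have cJ0 := cm.mul ((h.cy.pow 2).add (h.cw.pow 2))
  set J : ℝ := ∫ x in a..b, u x t ^ (1/5:ℝ) * v x t ^ (2/5:ℝ) *
        ((ux x t / u x t) ^ 2 + (vx x t / v x t) ^ 2) with hJ
  have hJ0 : 0 ≤ J := int_nonneg' h.hab.le fun x hx =>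
    mul_nonneg (h.mpos _ _ x hx t ht0).le (by positivity)
  set l := Real.sqrt (1 + J) with hl
  have hl2 : l ^ 2 = 1 + J := Real.sq_sqrt (by positivity)
  have hl1 : 1 ≤ l := by rw [hl, Real.one_le_sqrt]; linarith
  have c1 := ck.mul (((CO.const (3/5)).mul h.cy).add ((CO.const (1/5)).mul h.cw))
  have cg := ((CO.const l).mul h.cu).add ((CO.const (1/l)).mul cJ0)
  have h1 := sup_bound h.hab (fun x hx => h.dx_m (3/5) (1/5) ht0 hx) (c1.slice ht0)
    (cg.slice ht0) (fun x hx => ?_) hx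
  · rw [intervalIntegral.integral_add (((CO.const l).mul h.cu).ii h.hab.le ht0)
      (((CO.const (1/l)).mul cJ0).ii h.hab.le ht0), intervalIntegral.integral_const_mul,
      intervalIntegral.integral_const_mul] at h1
    have h2 := h.int_m_le hu hv (p := 3/5) (q := 1/5) (by norm_num) (by norm_num) (by norm_num) ht
    have h3 := mul_le_mul_of_nonneg_left h2 (show 0 ≤ 1 / (b - a) by positivity)
    have h4 : 1 / l * J ≤ l := by
      rw [one_div, inv_mul_eq_div, div_le_iff₀ (by linarith)]; nlinarith
    have h5 := mul_le_mul_of_nonneg_left (hu t ht) (show 0 ≤ l by linarith)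
    have h6 : 0 ≤ (1 / (b - a)) * ((b - a) + M + M) := by positivity
    have h7 : u x t ^ (3/5:ℝ) * v x t ^ (1/5:ℝ) ≤ C0 * l := by
      rw [hC0]; nlinarith
    calc (u x t ^ (3/5:ℝ) * v x t ^ (1/5:ℝ)) ^ 2 ≤ (C0 * l) ^ 2 :=
          pow_le_pow_left₀ (h.mpos _ _ x hx t ht0).le h7 2
      _ = C0 ^ 2 * (1 + J) := by rw [mul_pow, hl2]
  · have up := h.up x hx t ht0
    have vp := h.vp x hx t ht0
    have hm := h.mpos (1/5) (2/5) x hx t ht0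
    have hk2 : (u x t ^ (3/5:ℝ) * v x t ^ (1/5:ℝ)) ^ 2
        = u x t * (u x t ^ (1/5:ℝ) * v x t ^ (2/5:ℝ)) := by
      rw [mul_pow, ← Real.rpow_natCast, ← Real.rpow_natCast, ← Real.rpow_mul up.le,
        ← Real.rpow_mul vp.le, ← mul_assoc]
      nth_rewrite 2 [← Real.rpow_one (u x t)]
      rw [← Real.rpow_add up]
      norm_num
    have hl0 : 0 < l := by linarith
    have hl' : 0 < 1 / l := by positivity
    have hll : l * (1 / l) = 1 := by field_simp
    generalize u x t ^ (1/5:ℝ) * v x t ^ (2/5:ℝ) = m at *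
    generalize u x t ^ (3/5:ℝ) * v x t ^ (1/5:ℝ) = k at *
    generalize ux x t / u x t = y
    generalize vx x t / v x t = w
    generalize u x t = U at *
    generalize 1 / l = li at *
    apply abs_le_of_sq_le_sq
    · rw [mul_pow, hk2]
      have e1 : (3/5 * y + 1/5 * w) ^ 2 ≤ y ^ 2 + w ^ 2 := by
        nlinarith [sq_nonneg (y - 3 * w)]
      have e2 := mul_le_mul_of_nonneg_left e1 (mul_pos up hm).le
      have e3 : 0 ≤ U * m * (y ^ 2 + w ^ 2) := by positivity
      have e4 : (l * U + li * (m * (y ^ 2 + w ^ 2))) ^ 2 =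
        (l * U - li * (m * (y ^ 2 + w ^ 2))) ^ 2 + 4 * (l * li) * (U * m * (y ^ 2 + w ^ 2)) := by
        ring
      rw [e4, hll]
      nlinarith [sq_nonneg (l * U - li * (m * (y ^ 2 + w ^ 2)))]
    · positivity

/-- Square integrability on the interval. -/
def L2 (a b : ℝ) (f : ℝ → ℝ) : Prop := MemLp f 2 (volume.restrict (Ioc a b))

lemma L2.of_cont {f : ℝ → ℝ} (hf : ContinuousOn f (Icc a b)) : L2 a b f := by
  obtain ⟨K, hK⟩ := isCompact_Icc.exists_bound_of_continuousOn hf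
  refine MemLp.of_bound
    ((hf.mono Ioc_subset_Icc_self).aestronglyMeasurable measurableSet_Ioc) K ?_
  rw [ae_restrict_iff' measurableSet_Ioc]
  exact Eventually.of_forall fun x hx => hK x (Ioc_subset_Icc_self hx)

lemma L2.ii_mul (hab : a ≤ b) {f g : ℝ → ℝ} (hf : L2 a b f) (hg : L2 a b g) :
    IntervalIntegrable (fun x => f x * g x) volume a b := by
  rw [intervalIntegrable_iff_integrableOn_Ioc_of_le hab]
  exact MemLp.integrable_mul hf hg

lemma L2.ii_sq (hab : a ≤ b) {f : ℝ → ℝ} (hf : L2 a b f) :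
    IntervalIntegrable (fun x => f x ^ 2) volume a b := by
  simpa only [sq] using hf.ii_mul hab hf

lemma L2.sub {f g : ℝ → ℝ} (hf : L2 a b f) (hg : L2 a b g) :
    L2 a b (fun x => f x - g x) := MemLp.sub hf hg

lemma L2.add {f g : ℝ → ℝ} (hf : L2 a b f) (hg : L2 a b g) :
    L2 a b (fun x => f x + g x) := MemLp.add hf hg

lemma L2.const_mul {f : ℝ → ℝ} (c : ℝ) (hf : L2 a b f) :
    L2 a b (fun x => c * f x) := MemLp.const_mul hf c

lemma L2.ii (hab : a ≤ b) {f : ℝ → ℝ} (hf : L2 a b f) :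
    IntervalIntegrable f volume a b := by
  simpa using hf.ii_mul hab (L2.of_cont (f := fun _ => (1:ℝ)) continuousOn_const)

/-- Regularity of the reference profile. -/
structure SW (a b : ℝ) (w w1 w2 : ℝ → ℝ) : Prop where
  d1 : ∀ x ∈ Icc a b, HasDerivAt w (w1 x) x
  d2 : ∀ x ∈ Icc a b, HasDerivAt w1 (w2 x) x
  ba : w1 a = 0
  bb : w1 b = 0
  l2 : L2 a b w2

lemma SW.c0 {w w1 w2 : ℝ → ℝ} (hw : SW a b w w1 w2) : ContinuousOn w (Icc a b) :=
  fun x hx => (hw.d1 x hx).continuousAt.continuousWithinAt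

lemma SW.c1 {w w1 w2 : ℝ → ℝ} (hw : SW a b w w1 w2) : ContinuousOn w1 (Icc a b) :=
  fun x hx => (hw.d2 x hx).continuousAt.continuousWithinAt

lemma CO.of_x {w : ℝ → ℝ} (hw : ContinuousOn w (Icc a b)) : CO a b (fun x _ => w x) :=
  ContinuousOn.comp hw continuousOn_fst (fun _ hp => hp.1)

lemma Core.deriv_grad (h : Core a b χ u ux uxx ut v vx vxx vt B1 B2) {w w1 w2 : ℝ → ℝ}
    (hw : SW a b w w1 w2) {t : ℝ} (ht : 0 < t) :
    HasDerivAt (fun s => ∫ x in a..b, (vx x s - w1 x) ^ 2)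
      (-∫ x in a..b, vt x t * (vxx x t + vxx x t - 2 * w2 x)) t := by
  have hab := h.hab.le
  rw [hasDerivAt_iff_tendsto_slope]
  obtain ⟨K1, hK10, hK1⟩ := h.cvt.bdd ht
  obtain ⟨K2, hK20, hK2⟩ := h.cvxx.bdd ht
  have htm : t ∈ Icc (t/2) (t+1) := ⟨by linarith, by linarith⟩
  have key : ∀ s : ℝ, 0 < s → (∫ x in a..b, (vx x s - w1 x) ^ 2)
      - (∫ x in a..b, (vx x t - w1 x) ^ 2) =
      -∫ x in a..b, (v x s - v x t) * (vxx x s + vxx x t - 2 * w2 x) := by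
    intro s hs
    rw [← intervalIntegral.integral_sub
      (((h.cvx.sub (CO.of_x hw.c1)).pow 2).ii hab hs)
      (((h.cvx.sub (CO.of_x hw.c1)).pow 2).ii hab ht)]
    have hp := intervalIntegral.integral_mul_deriv_eq_deriv_mul (a := a) (b := b)
      (u := fun x => vx x s + vx x t - 2 * w1 x) (u' := fun x => vxx x s + vxx x t - 2 * w2 x)
      (v := fun x => v x s - v x t) (v' := fun x => vx x s - vx x t)
      (fun x hx => by
        rw [uIcc_of_le hab] at hx
        exact ((h.dvxx x hx s hs).add (h.dvxx x hx t ht)).sub ((hw.d2 x hx).const_mul 2))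
      (fun x hx => by
        rw [uIcc_of_le hab] at hx
        exact (h.dvx x hx s hs).sub (h.dvx x hx t ht))
      (((h.cvxx.ii hab hs).add (h.cvxx.ii hab ht)).sub ((hw.l2.const_mul 2).ii hab))
      ((h.cvx.ii hab hs).sub (h.cvx.ii hab ht))
    simp only [(h.vbc s hs).1, (h.vbc s hs).2, (h.vbc t ht).1, (h.vbc t ht).2, hw.ba, hw.bb] at hp
    have e1 : ∫ x in a..b, ((vx x s - w1 x) ^ 2 - (vx x t - w1 x) ^ 2) =
        ∫ x in a..b, (vx x s + vx x t - 2 * w1 x) * (vx x s - vx x t) := by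
      congr 1; ext x; ring
    have e2 : ∫ x in a..b, (v x s - v x t) * (vxx x s + vxx x t - 2 * w2 x) =
        ∫ x in a..b, (vxx x s + vxx x t - 2 * w2 x) * (v x s - v x t) := by
      congr 1; ext x; ring
    rw [e1, e2, hp]; ring
  have hev : ∀ᶠ s in 𝓝[≠] t, s ∈ Icc (t/2) (t+1) :=
    mem_nhdsWithin_of_mem_nhds (nhds_half ht)
  have hlim : Tendsto (fun s => ∫ x in a..b,
      ((s - t)⁻¹ * (v x s - v x t)) * (vxx x s + vxx x t - 2 * w2 x)) (𝓝[≠] t)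
      (𝓝 (∫ x in a..b, vt x t * (vxx x t + vxx x t - 2 * w2 x))) := by
    apply intervalIntegral.tendsto_integral_filter_of_dominated_convergence
      (fun x => K1 * (K2 + K2 + 2 * |w2 x|))
    · filter_upwards [hev] with s hs
      have hs0 : 0 < s := lt_of_lt_of_le (by linarith) hs.1
      have := ((L2.of_cont ((h.cv.slice hs0).sub (h.cv.slice ht))).const_mul ((s-t)⁻¹)).ii_mul hab
        (((L2.of_cont (h.cvxx.slice hs0)).add (L2.of_cont (h.cvxx.slice ht))).sub
          (hw.l2.const_mul 2))
      rw [uIoc_of_le hab]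
      rw [intervalIntegrable_iff_integrableOn_Ioc_of_le hab] at this
      exact this.aestronglyMeasurable
    · filter_upwards [hev, self_mem_nhdsWithin] with s hs hst
      refine Eventually.of_forall fun x hx => ?_
      rw [uIoc_of_le hab] at hx
      have hx := Ioc_subset_Icc_self hx
      have hst' : s - t ≠ 0 := sub_ne_zero.2 hst
      have b1 : |v x s - v x t| ≤ K1 * |s - t| := by
        have := Convex.norm_image_sub_le_of_norm_hasDerivWithin_le (f := fun s => v x s)
          (f' := fun s => vt x s) (C := K1) (s := Icc (t/2) (t+1)) (x := t) (y := s)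
          (fun r hr => (h.dvt x hx r (lt_of_lt_of_le (by linarith) hr.1)).hasDerivWithinAt)
          (fun r hr => hK1 x hx r hr) (convex_Icc _ _) htm hs
        simpa only [Real.norm_eq_abs] using this
      rw [Real.norm_eq_abs, abs_mul, abs_mul, abs_inv]
      have b2 : |s - t|⁻¹ * |v x s - v x t| ≤ K1 := by
        rw [inv_mul_eq_div, div_le_iff₀ (abs_pos.2 hst')]; exact b1
      have b3 : |vxx x s + vxx x t - 2 * w2 x| ≤ K2 + K2 + 2 * |w2 x| := by
        have e1 := hK2 x hx s hs
        have e2 := hK2 x hx t htm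
        have e3 := abs_sub (vxx x s + vxx x t) (2 * w2 x)
        have e4 := abs_add_le (vxx x s) (vxx x t)
        rw [abs_mul, abs_two] at e3
        linarith
      exact mul_le_mul b2 b3 (abs_nonneg _) hK10
    · exact (intervalIntegrable_const.add ((hw.l2.ii hab).abs.const_mul 2)).const_mul K1
    · refine Eventually.of_forall fun x hx => ?_
      rw [uIoc_of_le hab] at hx
      have hx := Ioc_subset_Icc_self hx
      have hd := h.dvt x hx t ht
      rw [hasDerivAt_iff_tendsto_slope] at hd
      have hc : Tendsto (fun s => vxx x s) (𝓝[≠] t) (𝓝 (vxx x t)) :=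
        (((h.cvxx.slice' hx).continuousAt (Ioi_mem_nhds ht)).tendsto).mono_left nhdsWithin_le_nhds
      exact Tendsto.mul hd ((hc.add_const _).sub_const _)
  refine (hlim.neg).congr' ?_
  filter_upwards [hev] with s hs
  have hs0 : 0 < s := lt_of_lt_of_le (by linarith) hs.1
  rw [slope_def_module, key s hs0, smul_eq_mul, mul_neg, ← intervalIntegral.integral_const_mul]
  congr 2
  ext x; ring

lemma Core.energy (h : Core a b χ u ux uxx ut v vx vxx vt B1 B2) {w w1 w2 : ℝ → ℝ}
    (hw : SW a b w w1 w2) :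
    ∃ E' : ℝ → ℝ, (∀ t : ℝ, 0 < t → HasDerivAt
      (fun s => (∫ x in a..b, (v x s - w x) ^ 2) + ∫ x in a..b, (vx x s - w1 x) ^ 2) (E' t) t) ∧
      ∀ t : ℝ, 0 < t → E' t ≤
        -((∫ x in a..b, (v x t - w x) ^ 2) + ∫ x in a..b, (vx x t - w1 x) ^ 2) +
          ∫ x in a..b, (u x t * v x t + B2 x t - (w x - w2 x)) ^ 2 := by
  have hab := h.hab.le
  have cz := h.cv.sub (CO.of_x hw.c0)
  have czx := h.cvx.sub (CO.of_x hw.c1)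
  refine ⟨fun t => (∫ x in a..b, 2 * ((v x t - w x) * vt x t)) +
    -∫ x in a..b, vt x t * (vxx x t + vxx x t - 2 * w2 x), fun t ht => ?_, fun t ht => ?_⟩
  · refine HasDerivAt.add ?_ (h.deriv_grad hw ht)
    refine (cz.pow 2).deriv_int hab ((CO.const 2).mul (cz.mul h.cvt)) ?_ ht
    intro x hx t ht
    refine (((h.dvt x hx t ht).sub_const (w x)).pow 2).congr_deriv ?_
    simp; ring
  · have lz : L2 a b (fun x => v x t - w x) := L2.of_cont (cz.slice ht)
    have lvt : L2 a b (fun x => vt x t) := L2.of_cont (h.cvt.slice ht)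
    have lzxx : L2 a b (fun x => vxx x t - w2 x) := (L2.of_cont (h.cvxx.slice ht)).sub hw.l2
    have lq : L2 a b (fun x => vxx x t + vxx x t - 2 * w2 x) :=
      ((L2.of_cont (h.cvxx.slice ht)).add (L2.of_cont (h.cvxx.slice ht))).sub (hw.l2.const_mul 2)
    have lF : L2 a b (fun x => u x t * v x t + B2 x t - (w x - w2 x)) :=
      (L2.of_cont (((h.cu.mul h.cv).add h.cB2).slice ht)).sub ((L2.of_cont hw.c0).sub hw.l2)
    have hp := intervalIntegral.integral_mul_deriv_eq_deriv_mul (a := a) (b := b)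
      (u := fun x => v x t - w x) (u' := fun x => vx x t - w1 x)
      (v := fun x => vx x t - w1 x) (v' := fun x => vxx x t - w2 x)
      (fun x hx => by
        rw [uIcc_of_le hab] at hx
        exact (h.dvx x hx t ht).sub (hw.d1 x hx))
      (fun x hx => by
        rw [uIcc_of_le hab] at hx
        exact (h.dvxx x hx t ht).sub (hw.d2 x hx))
      (czx.ii hab ht) (lzxx.ii hab)
    simp only [(h.vbc t ht).1, (h.vbc t ht).2, hw.ba, hw.bb] at hp
    have hz2 : 0 ≤ ∫ x in a..b, (vx x t - w1 x) ^ 2 := int_nonneg' hab fun x _ => sq_nonneg _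
    have e0 : ∫ x in a..b, (vx x t - w1 x) * (vx x t - w1 x) =
      ∫ x in a..b, (vx x t - w1 x) ^ 2 := by congr 1; ext x; ring
    have i1 : IntervalIntegrable (fun x => 2 * ((v x t - w x) * vt x t)) volume a b :=
      (lz.ii_mul hab lvt).const_mul 2
    have i2 := lvt.ii_mul hab lq
    have i3 := lz.ii_sq hab
    have i4 : IntervalIntegrable (fun x => 2 * ((v x t - w x) * (vxx x t - w2 x))) volume a b :=
      (lz.ii_mul hab lzxx).const_mul 2
    have i5 := lF.ii_sq hab
    have hm := intervalIntegral.integral_mono_on hab (i1.sub i2) ((i4.sub i3).add i5) (fun x hx => by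
      have e := h.veq x hx t ht
      have : vt x t = -((v x t - w x) - (vxx x t - w2 x)) +
        (u x t * v x t + B2 x t - (w x - w2 x)) := by rw [e]; ring
      generalize (u x t * v x t + B2 x t - (w x - w2 x)) = F at *
      have e2 : vxx x t + vxx x t - 2 * w2 x = 2 * (vxx x t - w2 x) := by ring
      rw [e2, this]
      generalize v x t - w x = z
      generalize vxx x t - w2 x = y
      nlinarith [sq_nonneg (z - y - F), sq_nonneg y])
    rw [intervalIntegral.integral_sub i1 i2, intervalIntegral.integral_add (i4.sub i3) i5,
      intervalIntegral.integral_sub i4 i3, intervalIntegral.integral_const_mul 2 (fun x => (v x t - w x) * (vxx x t - w2 x)),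
      hp, e0] at hm
    simp only
    linarith

lemma Core.sobolev (h : Core a b χ u ux uxx ut v vx vxx vt B1 B2) {w w1 w2 : ℝ → ℝ}
    (hw : SW a b w w1 w2) {t : ℝ} (ht : 0 < t) {x : ℝ} (hx : x ∈ Icc a b) :
    (v x t - w x) ^ 2 ≤ (1 / (b - a) + 1) *
      ((∫ x in a..b, (v x t - w x) ^ 2) + ∫ x in a..b, (vx x t - w1 x) ^ 2) := by
  have hab := h.hab.le
  have hL : 0 < b - a := sub_pos.2 h.hab
  have cz := h.cv.sub (CO.of_x hw.c0)
  have czx := h.cvx.sub (CO.of_x hw.c1)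
  have h1 := sup_bound h.hab (f := fun x => (v x t - w x) ^ 2)
    (f1 := fun x => 2 * ((v x t - w x) * (vx x t - w1 x)))
    (g := fun x => (v x t - w x) ^ 2 + (vx x t - w1 x) ^ 2) (fun x hx => by
      refine (((h.dvx x hx t ht).sub (hw.d1 x hx)).pow 2).congr_deriv ?_
      simp; ring) (((CO.const 2).mul (cz.mul czx)).slice ht)
    (((cz.pow 2).add (czx.pow 2)).slice ht) (fun x hx => by
      rw [abs_le]
      constructor <;> nlinarith [sq_nonneg ((v x t - w x) + (vx x t - w1 x)),
        sq_nonneg ((v x t - w x) - (vx x t - w1 x))]) hx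
  rw [intervalIntegral.integral_add ((cz.pow 2).ii hab ht) ((czx.pow 2).ii hab ht)] at h1
  have hz2 : 0 ≤ ∫ x in a..b, (vx x t - w1 x) ^ 2 := int_nonneg' hab fun x _ => sq_nonneg _
  have : 0 ≤ 1 / (b - a) * ∫ x in a..b, (vx x t - w1 x) ^ 2 := by positivity
  simp only at h1
  linarith

lemma X_eq {x y : ℝ} (hx : 0 < x) (hy : 0 < y) :
    x * y ^ (1/3:ℝ) = ((x ^ (3/5:ℝ) * y ^ (1/5:ℝ)) ^ 2) ^ (5/6:ℝ) := by
  have hk : 0 < x ^ (3/5:ℝ) * y ^ (1/5:ℝ) :=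
    mul_pos (Real.rpow_pos_of_pos hx _) (Real.rpow_pos_of_pos hy _)
  rw [← Real.rpow_natCast, ← Real.rpow_mul hk.le, Real.mul_rpow (Real.rpow_nonneg hx.le _)
    (Real.rpow_nonneg hy.le _), ← Real.rpow_mul hx.le, ← Real.rpow_mul hy.le]
  norm_num

lemma sw_zero : SW a b (fun _ => 0) (fun _ => 0) (fun _ => 0) where
  d1 := fun x _ => hasDerivAt_const x 0
  d2 := fun x _ => hasDerivAt_const x 0
  ba := rfl
  bb := rfl
  l2 := L2.of_cont continuousOn_const

/-- Sublinear feedback: `G' ≤ -G + φ G^(5/6)` yields boundedness. -/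
lemma ode_power {G G' J : ℝ → ℝ} {C KJ : ℝ} (hC : 0 ≤ C)
    (hG1 : ∀ t : ℝ, 0 < t → 1 ≤ G t)
    (hd : ∀ t : ℝ, 0 < t → HasDerivAt G (G' t) t)
    (hJc : ContinuousOn J (Ioi 0)) (hJ0 : ∀ t : ℝ, 0 < t → 0 ≤ J t)
    (hle : ∀ t : ℝ, 1 ≤ t → G' t ≤ - G t + C * (1 + J t) * G t ^ (5/6:ℝ))
    (hKJ : ∀ t : ℝ, 1 ≤ t → ∫ s in t..(t+1), J s ≤ KJ) :
    ∃ K : ℝ, ∀ t : ℝ, 1 ≤ t → G t ≤ K := by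
  have hode := ode_bound (H := fun t => G t ^ (1/6:ℝ))
    (H' := fun t => G' t * (1/6) * G t ^ ((1/6:ℝ) - 1))
    (φ := fun t => (C / 6) * (1 + J t)) (κ := 1/6) (K := (C/6) * (1 + KJ)) (T := 1)
    (by norm_num) one_pos
    (fun t ht => (hd t ht).rpow_const (Or.inl (by linarith [hG1 t ht])))
    (continuousOn_const.mul (continuousOn_const.add hJc))
    (fun t ht => mul_nonneg (by positivity) (by linarith [hJ0 t ht])) ?_ ?_
  · set Q := (C/6) * (1 + KJ) with hQ
    have hKJ0 : 0 ≤ KJ := le_trans (intervalIntegral.integral_nonneg (by norm_num)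
      fun s hs => hJ0 s (by linarith [hs.1])) (hKJ 1 le_rfl)
    refine ⟨(G 1 ^ (1/6:ℝ) + (Q / (1 - Real.exp (-(1/6))) + Q)) ^ 6, fun t ht => ?_⟩
    have h1 := hode t ht
    have hGt := hG1 t (by linarith)
    have hG11 := hG1 1 one_pos
    have h3 : Real.exp (-(1/6) * (t - 1)) ≤ 1 := by rw [Real.exp_le_one_iff]; linarith
    have h4 := mul_le_mul_of_nonneg_right h3 (Real.rpow_nonneg (by linarith : 0 ≤ G 1) (1/6:ℝ))
    have h5 : G t ^ (1/6:ℝ) ≤ G 1 ^ (1/6:ℝ) + (Q / (1 - Real.exp (-(1/6))) + Q) := by linarith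
    calc G t = (G t ^ (1/6:ℝ)) ^ 6 := by
          rw [← Real.rpow_natCast, ← Real.rpow_mul (by linarith)]; norm_num
      _ ≤ _ := pow_le_pow_left₀ (Real.rpow_nonneg (by linarith) _) h5 6
  · intro t ht
    have hGt := hG1 t (by linarith)
    have hG0 : 0 < G t := by linarith
    have e1 : G t * G t ^ ((1/6:ℝ) - 1) = G t ^ (1/6:ℝ) := by
      nth_rewrite 1 [← Real.rpow_one (G t)]
      rw [← Real.rpow_add hG0]; norm_num
    have e2 : G t ^ (5/6:ℝ) * G t ^ ((1/6:ℝ) - 1) = 1 := by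
      rw [← Real.rpow_add hG0]; norm_num
    have e3 := mul_le_mul_of_nonneg_right (hle t ht) (Real.rpow_nonneg hG0.le ((1/6:ℝ) - 1))
    have e4 : (- G t + C * (1 + J t) * G t ^ (5/6:ℝ)) * G t ^ ((1/6:ℝ) - 1)
        = - G t ^ (1/6:ℝ) + C * (1 + J t) := by
      rw [add_mul, neg_mul, e1, mul_assoc, e2, mul_one]
    rw [e4] at e3
    linarith
  · intro t ht
    have ht0 : 0 < t := by linarith
    rw [intervalIntegral.integral_const_mul, intervalIntegral.integral_add intervalIntegrable_const
      (ii_of_pos hJc ht0 (by linarith)), intervalIntegral.integral_const, smul_eq_mul]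
    have := hKJ t ht
    have hC6 : 0 ≤ C / 6 := by positivity
    nlinarith

lemma Core.v_bdd (h : Core a b χ u ux uxx ut v vx vxx vt B1 B2) {M N K KJ : ℝ} {J : ℝ → ℝ}
    (hN2 : ∀ x t : ℝ, B2 x t ≤ N) (hK0 : 0 ≤ K)
    (hu : ∀ t : ℝ, 1 ≤ t → ∫ x in a..b, u x t ≤ M)
    (hJc : ContinuousOn J (Ioi 0)) (hJ0 : ∀ t : ℝ, 0 < t → 0 ≤ J t)
    (hKJ : ∀ t : ℝ, 1 ≤ t → ∫ s in t..(t+1), J s ≤ KJ)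
    (hk : ∀ t : ℝ, 1 ≤ t → ∀ x ∈ Icc a b,
      (u x t ^ (3/5:ℝ) * v x t ^ (1/5:ℝ)) ^ 2 ≤ K * (1 + J t)) :
    ∃ C : ℝ, 0 ≤ C ∧ ∀ t : ℝ, 1 ≤ t → ∀ x ∈ Icc a b, v x t ≤ C := by
  have hab := h.hab.le
  have hL : 0 < b - a := sub_pos.2 h.hab
  have hM0 : 0 ≤ M := le_trans
    (int_nonneg' h.hab.le fun x hx => (h.up x hx 1 one_pos).le) (hu 1 le_rfl)
  obtain ⟨E', hE', hEle⟩ := h.energy (sw_zero (a := a) (b := b))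
  set E : ℝ → ℝ := fun s => (∫ x in a..b, (v x s - 0) ^ 2) + ∫ x in a..b, (vx x s - 0) ^ 2 with hE
  have hE0 : ∀ t, 0 ≤ E t := fun t => add_nonneg (int_nonneg' hab fun x _ => sq_nonneg _)
    (int_nonneg' hab fun x _ => sq_nonneg _)
  set S := 1 / (b - a) + 1 with hS
  have hS0 : 0 < S := by positivity
  have hsob : ∀ t : ℝ, 0 < t → ∀ x ∈ Icc a b, v x t ^ 2 ≤ S * E t := by
    intro t ht x hx
    have := h.sobolev (sw_zero (a := a) (b := b)) ht hx
    rw [sub_zero] at this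
    exact this
  set C := 2 * M * (1 + K) * S ^ (5/6:ℝ) + 2 * N ^ 2 * (b - a) + 1 with hC
  have hSp : 0 ≤ S ^ (5/6:ℝ) := Real.rpow_nonneg hS0.le _
  have hC0 : 0 ≤ C := by positivity
  have hkey : ∀ t : ℝ, 1 ≤ t → E' t ≤ -(E t + 1) + C * (1 + J t) * (E t + 1) ^ (5/6:ℝ) := by
    intro t ht
    have ht0 : 0 < t := by linarith
    have h1 := hEle t ht0
    have hJt := hJ0 t ht0
    have hEt := hE0 t
    set G := E t + 1 with hG
    have hGp : 1 ≤ G ^ (5/6:ℝ) := Real.one_le_rpow (by linarith) (by norm_num)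
    have hpt : ∀ x ∈ Icc a b, (u x t * v x t + B2 x t - (0 - 0)) ^ 2 ≤
        (2 * ((1 + K * (1 + J t)) * (S ^ (5/6:ℝ) * G ^ (5/6:ℝ)))) * u x t + 2 * N ^ 2 := by
      intro x hx
      have up := h.up x hx t ht0
      have vp := h.vp x hx t ht0
      have hX : u x t * v x t ^ (1/3:ℝ) ≤ 1 + K * (1 + J t) := by
        rw [X_eq up vp]
        have := rpow_le_one_add (x := (u x t ^ (3/5:ℝ) * v x t ^ (1/5:ℝ)) ^ 2) (p := 5/6)
          (pow_pos (h.mpos _ _ x hx t ht0) 2) (by norm_num) (by norm_num)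
        linarith [hk t ht x hx]
      have hV : v x t ^ (5/3:ℝ) ≤ S ^ (5/6:ℝ) * G ^ (5/6:ℝ) := by
        rw [← Real.mul_rpow hS0.le (by linarith)]
        have e : v x t ^ (5/3:ℝ) = (v x t ^ 2) ^ (5/6:ℝ) := by
          rw [← Real.rpow_natCast, ← Real.rpow_mul vp.le]; norm_num
        rw [e]
        apply Real.rpow_le_rpow (by positivity) _ (by norm_num)
        refine (hsob t ht0 x hx).trans (mul_le_mul_of_nonneg_left ?_ hS0.le)
        linarith
      have e2 : (u x t * v x t) ^ 2 = u x t * ((u x t * v x t ^ (1/3:ℝ)) * v x t ^ (5/3:ℝ)) := by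
        have : v x t ^ 2 = v x t ^ (1/3:ℝ) * v x t ^ (5/3:ℝ) := by
          rw [← Real.rpow_add vp]; norm_num
        rw [mul_pow, this]; ring
      have e3 : (u x t * v x t ^ (1/3:ℝ)) * v x t ^ (5/3:ℝ) ≤
          (1 + K * (1 + J t)) * (S ^ (5/6:ℝ) * G ^ (5/6:ℝ)) :=
        mul_le_mul hX hV (Real.rpow_nonneg vp.le _) (by positivity)
      have e4 := mul_le_mul_of_nonneg_left e3 up.le
      have e5 : B2 x t ^ 2 ≤ N ^ 2 := pow_le_pow_left₀ (h.B2n x t) (hN2 x t) 2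
      nlinarith [sq_nonneg (u x t * v x t - B2 x t)]
    have cl := (((h.cu.mul h.cv).add h.cB2).sub (CO.const (0 - 0))).pow 2
    have cr := ((CO.const (2 * ((1 + K * (1 + J t)) * (S ^ (5/6:ℝ) * G ^ (5/6:ℝ))))).mul h.cu).add
      (CO.const (2 * N ^ 2))
    have h2 := cl.int_mono hab cr ht0 hpt
    rw [intervalIntegral.integral_add (((CO.const _).mul h.cu).ii hab ht0)
      ((CO.const _).ii hab ht0), intervalIntegral.integral_const_mul,
      intervalIntegral.integral_const, smul_eq_mul] at h2
    have h3 : (2 * ((1 + K * (1 + J t)) * (S ^ (5/6:ℝ) * G ^ (5/6:ℝ)))) * (∫ x in a..b, u x t)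
      ≤ (2 * (((1 + K) * (1 + J t)) * (S ^ (5/6:ℝ) * G ^ (5/6:ℝ)))) * M := by
      apply mul_le_mul _ (hu t ht) (int_nonneg' hab fun x hx => (h.up x hx t ht0).le)
        (by positivity)
      apply mul_le_mul_of_nonneg_left _ (by norm_num)
      apply mul_le_mul_of_nonneg_right _ (by positivity)
      nlinarith
    have h4 : 2 * N ^ 2 * (b - a) + 1 ≤ (2 * N ^ 2 * (b - a) + 1) * ((1 + J t) * G ^ (5/6:ℝ)) := by
      apply le_mul_of_one_le_right (by positivity)
      nlinarith
    have h5 : C * (1 + J t) * G ^ (5/6:ℝ) =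
      (2 * (((1 + K) * (1 + J t)) * (S ^ (5/6:ℝ) * G ^ (5/6:ℝ)))) * M +
        (2 * N ^ 2 * (b - a) + 1) * ((1 + J t) * G ^ (5/6:ℝ)) := by rw [hC]; ring
    rw [h5]
    have h6 : -((∫ x in a..b, (v x t - 0) ^ 2) + ∫ x in a..b, (vx x t - 0) ^ 2) = -G + 1 := by
      rw [hG, hE]; ring
    rw [h6] at h1
    refine h1.trans ((add_le_add (le_refl (-G + 1)) h2).trans ?_)
    linarith
  obtain ⟨Q, hQ⟩ := ode_power (G := fun t => E t + 1) (G' := E') (J := J) (C := C) (KJ := KJ) hC0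
    (fun t _ => by linarith [hE0 t]) (fun t ht => (hE' t ht).add_const 1) hJc hJ0 hkey hKJ
  refine ⟨Real.sqrt (S * Q), Real.sqrt_nonneg _, fun t ht x hx => ?_⟩
  apply Real.le_sqrt_of_sq_le
  refine (hsob t (by linarith) x hx).trans (mul_le_mul_of_nonneg_left ?_ hS0.le)
  have := hQ t ht
  linarith

lemma ode_zero {E E' : ℝ → ℝ}
    (hd : ∀ t : ℝ, 0 < t → HasDerivAt E (E' t) t)
    (hyp : ∀ ε : ℝ, 0 < ε → ∃ (φ : ℝ → ℝ) (T : ℝ), 0 < T ∧ ContinuousOn φ (Ioi 0) ∧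
      (∀ t : ℝ, 0 < t → 0 ≤ φ t) ∧ (∀ t : ℝ, T ≤ t → E' t ≤ - E t + φ t) ∧
      (∀ t : ℝ, T ≤ t → ∫ r in t..(t+1), φ r ≤ ε)) :
    ∀ ε : ℝ, 0 < ε → ∃ T : ℝ, 0 < T ∧ ∀ t : ℝ, T ≤ t → E t ≤ ε := by
  intro ε hε
  have hexp : Real.exp (-1) < 1 := by rw [Real.exp_lt_one_iff]; norm_num
  set c := 1 / (1 - Real.exp (-1)) + 1 with hc
  have hc0 : 0 < c := by
    have : 0 < 1 - Real.exp (-1) := by linarith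
    positivity
  obtain ⟨φ, T, hT, hφ, hφ0, hle, hK⟩ := hyp (ε / (2 * c)) (by positivity)
  have hode := ode_bound (κ := 1) one_pos hT hd hφ hφ0
    (fun t ht => by rw [neg_one_mul]; exact hle t ht) hK
  have hlim : Tendsto (fun t : ℝ => Real.exp (-1 * (t - T)) * E T) atTop (𝓝 (0 * E T)) := by
    apply Tendsto.mul_const
    apply Real.tendsto_exp_atBot.comp
    apply Tendsto.const_mul_atTop_of_neg (by norm_num)
    exact tendsto_atTop_add_const_right _ _ tendsto_id
  rw [zero_mul] at hlim
  have hev := hlim.eventually (gt_mem_nhds (show 0 < ε / 2 by positivity))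
  obtain ⟨T1, hT1⟩ := eventually_atTop.1 hev
  refine ⟨max T T1, lt_of_lt_of_le hT (le_max_left _ _), fun t ht => ?_⟩
  have h1 := hode t ((le_max_left _ _).trans ht)
  have h2 := hT1 t ((le_max_right _ _).trans ht)
  have h3 : (ε / (2 * c)) / (1 - Real.exp (-1)) + ε / (2 * c) = ε / 2 := by
    have : (ε / (2 * c)) / (1 - Real.exp (-1)) + ε / (2 * c) = (ε / (2 * c)) * c := by
      rw [hc]; ring
    rw [this]; field_simp
  rw [h3] at h1
  linarith

lemma tail_zero {η : ℝ → ℝ} {M : ℝ} (hc : ContinuousOn η (Ioi 0)) (h0 : ∀ t : ℝ, 0 < t → 0 ≤ η t)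
    (hM : ∀ T : ℝ, 1 ≤ T → ∫ t in (1:ℝ)..T, η t ≤ M) :
    Tendsto (fun t => ∫ s in t..(t+1), η s) atTop (𝓝 0) := by
  set R : ℝ → ℝ := fun T => ∫ t in (1:ℝ)..(max T 1), η t with hR
  have add : ∀ s t : ℝ, 1 ≤ s → s ≤ t → (∫ r in (1:ℝ)..s, η r) + (∫ r in s..t, η r) =
      ∫ r in (1:ℝ)..t, η r := fun s t hs hst =>
    intervalIntegral.integral_add_adjacent_intervals (ii_of_pos hc one_pos hs)
      (ii_of_pos hc (by linarith) hst)
  have hmono : Monotone R := by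
    intro s t hst
    have h1 := add (max s 1) (max t 1) (le_max_right _ _) (max_le_max hst le_rfl)
    have h2 : 0 ≤ ∫ r in (max s 1)..(max t 1), η r :=
      intervalIntegral.integral_nonneg (max_le_max hst le_rfl) fun r hr =>
        h0 r (lt_of_lt_of_le one_pos ((le_max_right _ _).trans hr.1))
    simp only [hR]; linarith
  have hbdd : BddAbove (range R) := ⟨M, by rintro _ ⟨t, rfl⟩; exact hM _ (le_max_right _ _)⟩
  have hl := tendsto_atTop_ciSup hmono hbdd
  have hl1 := hl.comp (tendsto_atTop_add_const_right atTop (1:ℝ) tendsto_id)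
  have hl2 := hl1.sub hl
  rw [sub_self] at hl2
  refine hl2.congr' ?_
  filter_upwards [eventually_ge_atTop (1:ℝ)] with t ht
  have h1 := add t (t+1) ht (by linarith)
  simp only [hR, Function.comp, id]
  rw [max_eq_left ht, max_eq_left (by linarith : 1 ≤ t + 1)]
  linarith

lemma rpow_interp {δ : ℝ} (hδ : 0 < δ) : ∃ C : ℝ, 0 ≤ C ∧ ∀ P : ℝ, 0 ≤ P →
    P ^ (5/6:ℝ) ≤ δ * P + C := by
  have hR : 0 < (1/δ) ^ 6 := by positivity
  refine ⟨((1/δ) ^ 6) ^ (5/6:ℝ), Real.rpow_nonneg hR.le _, fun P hP => ?_⟩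
  rcases le_total P ((1/δ) ^ 6) with h | h
  · have := Real.rpow_le_rpow hP h (show (0:ℝ) ≤ 5/6 by norm_num)
    have : 0 ≤ δ * P := by positivity
    linarith
  · have hP0 : 0 < P := lt_of_lt_of_le hR h
    have h1 := Real.rpow_le_rpow hR.le h (show (0:ℝ) ≤ 1/6 by norm_num)
    have h2 : ((1/δ) ^ 6) ^ (1/6:ℝ) = 1 / δ := by
      rw [← Real.rpow_natCast, ← Real.rpow_mul (by positivity)]; norm_num
    rw [h2, div_le_iff₀ hδ] at h1
    have h3 : P = P ^ (5/6:ℝ) * P ^ (1/6:ℝ) := by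
      rw [← Real.rpow_add hP0]; norm_num
    have h4 := Real.rpow_nonneg hP (5/6:ℝ)
    have h5 := Real.rpow_nonneg hR.le (5/6:ℝ)
    have h6 : δ * P = P ^ (5/6:ℝ) * (P ^ (1/6:ℝ) * δ) := by
      nth_rewrite 1 [h3]; ring
    nlinarith

lemma CO.cont_int_mul (hab : a ≤ b) {f : ℝ → ℝ → ℝ} {β : ℝ → ℝ} (hf : CO a b f)
    (hβ : L2 a b β) : ContinuousOn (fun t => ∫ x in a..b, f x t * β x) (Ioi 0) := by
  intro t ht
  apply ContinuousAt.continuousWithinAt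
  obtain ⟨K, hK0, hK⟩ := hf.bdd (t := t) ht
  apply intervalIntegral.tendsto_integral_filter_of_dominated_convergence (fun x => K * |β x|)
  · filter_upwards [Ioi_mem_nhds (show (0:ℝ) < t from ht)] with s hs
    have := (L2.of_cont (hf.slice hs)).ii_mul hab hβ
    rw [intervalIntegrable_iff_integrableOn_Ioc_of_le hab] at this
    rw [uIoc_of_le hab]
    exact this.aestronglyMeasurable
  · filter_upwards [nhds_half ht] with s hs
    refine Eventually.of_forall fun x hx => ?_
    rw [uIoc_of_le hab] at hx
    rw [Real.norm_eq_abs, abs_mul]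
    exact mul_le_mul_of_nonneg_right (hK x (Ioc_subset_Icc_self hx) s hs) (abs_nonneg _)
  · exact (hβ.ii hab).abs.const_mul K
  · refine Eventually.of_forall fun x hx => ?_
    rw [uIoc_of_le hab] at hx
    exact (((hf.slice' (Ioc_subset_Icc_self hx)).continuousAt (Ioi_mem_nhds ht)).tendsto).mul_const _

lemma Core.v_conv (h : Core a b χ u ux uxx ut v vx vxx vt B1 B2) {M C K KJ : ℝ} {J : ℝ → ℝ}
    {w w1 w2 : ℝ → ℝ} (hw : SW a b w w1 w2) (hK0 : 0 ≤ K) (hC0 : 0 ≤ C)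
    (hu : ∀ t : ℝ, 1 ≤ t → ∫ x in a..b, u x t ≤ M)
    (huv : ∀ T : ℝ, 1 ≤ T → ∫ t in (1:ℝ)..T, ∫ x in a..b, u x t * v x t ≤ M)
    (hJc : ContinuousOn J (Ioi 0)) (hJ0 : ∀ t : ℝ, 0 < t → 0 ≤ J t)
    (hKJ : ∀ t : ℝ, 1 ≤ t → ∫ s in t..(t+1), J s ≤ KJ)
    (hk : ∀ t : ℝ, 1 ≤ t → ∀ x ∈ Icc a b,
      (u x t ^ (3/5:ℝ) * v x t ^ (1/5:ℝ)) ^ 2 ≤ K * (1 + J t))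
    (hvC : ∀ t : ℝ, 1 ≤ t → ∀ x ∈ Icc a b, v x t ≤ C)
    (hg : Tendsto (fun t : ℝ => ∫ s in t..(t+1), ∫ x in a..b, (B2 x s - (w x - w2 x)) ^ 2)
      atTop (𝓝 0)) :
    ∀ ε : ℝ, 0 < ε → ∃ T : ℝ, 0 < T ∧ ∀ t : ℝ, T ≤ t → ∀ x ∈ Icc a b, |v x t - w x| < ε := by
  have hab := h.hab.le
  have hL : 0 < b - a := sub_pos.2 h.hab
  have hM0 : 0 ≤ M := le_trans
    (int_nonneg' h.hab.le fun x hx => (h.up x hx 1 one_pos).le) (hu 1 le_rfl)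
  have hKJ0 : 0 ≤ KJ := le_trans (intervalIntegral.integral_nonneg (by norm_num)
      fun s hs => hJ0 s (by linarith [hs.1])) (hKJ 1 le_rfl)
  obtain ⟨E', hE', hEle⟩ := h.energy hw
  set E : ℝ → ℝ := fun s => (∫ x in a..b, (v x s - w x) ^ 2) + ∫ x in a..b, (vx x s - w1 x) ^ 2
    with hE
  have lβ : L2 a b (fun x => w x - w2 x) := (L2.of_cont hw.c0).sub hw.l2
  have cη := (h.cu.mul h.cv).cont_int hab
  set η : ℝ → ℝ := fun s => ∫ x in a..b, u x s * v x s with hη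
  set g : ℝ → ℝ := fun s => ∫ x in a..b, (B2 x s - (w x - w2 x)) ^ 2 with hgdef
  have hη0 : ∀ t : ℝ, 0 < t → 0 ≤ η t := fun t ht =>
    int_nonneg' h.hab.le fun x hx => (mul_pos (h.up x hx t ht) (h.vp x hx t ht)).le
  have hg0 : ∀ t : ℝ, 0 ≤ g t := fun t => int_nonneg' hab fun x _ => sq_nonneg _
  have cg : ContinuousOn g (Ioi 0) := by
    have c1 := (((h.cB2.pow 2).cont_int hab).sub
      (continuousOn_const.mul (h.cB2.cont_int_mul hab lβ) (s := Ioi 0) (f := fun _ => (2:ℝ)))).add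
      (continuousOn_const (s := Ioi 0) (c := ∫ x in a..b, (w x - w2 x) ^ 2))
    refine c1.congr fun t ht => ?_
    have ht : 0 < t := ht
    have i1 := (h.cB2.pow 2).ii hab ht
    have i2 := ((L2.of_cont (h.cB2.slice ht)).ii_mul hab lβ).const_mul 2
    have i3 := lβ.ii_sq hab
    simp only [hgdef, Pi.add_apply, Pi.sub_apply, Pi.mul_apply]
    rw [← intervalIntegral.integral_const_mul, ← intervalIntegral.integral_sub i1 i2,
      ← intervalIntegral.integral_add (i1.sub i2) i3]
    congr 1; ext x; ring
  have tη := tail_zero cη hη0 huv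
  have hηM : ∀ t : ℝ, 1 ≤ t → η t ≤ C * M := by
    intro t ht
    have ht0 : 0 < t := by linarith
    have h1 := (h.cu.mul h.cv).int_mono hab ((CO.const C).mul h.cu) ht0 (fun x hx => by
      have := mul_le_mul_of_nonneg_left (hvC t ht x hx) (h.up x hx t ht0).le
      linarith)
    rw [intervalIntegral.integral_const_mul] at h1
    exact h1.trans (mul_le_mul_of_nonneg_left (hu t ht) hC0)
  set C' := C ^ (2/3:ℝ) with hC'
  have hC'0 : 0 ≤ C' := Real.rpow_nonneg hC0 _
  have hF : ∀ t : ℝ, 1 ≤ t → ∫ x in a..b, (u x t * v x t + B2 x t - (w x - w2 x)) ^ 2 ≤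
      2 * (C' * (K * (1 + J t)) ^ (5/6:ℝ)) * η t + 2 * g t := by
    intro t ht
    have ht0 : 0 < t := by linarith
    have hJt := hJ0 t ht0
    rw [hη, hgdef]
    simp only
    have i1 : IntervalIntegrable (fun x => (2 * (C' * (K * (1 + J t)) ^ (5/6:ℝ))) *
        (u x t * v x t)) volume a b := ((h.cu.mul h.cv).ii hab ht0).const_mul _
    have i2 : IntervalIntegrable (fun x => 2 * (B2 x t - (w x - w2 x)) ^ 2) volume a b :=
      (((L2.of_cont (h.cB2.slice ht0)).sub lβ).ii_sq hab).const_mul 2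
    have i3 := ((L2.of_cont (((h.cu.mul h.cv).add h.cB2).slice ht0)).sub lβ).ii_sq hab
    rw [← intervalIntegral.integral_const_mul, ← intervalIntegral.integral_const_mul,
      ← intervalIntegral.integral_add i1 i2]
    refine intervalIntegral.integral_mono_on hab i3 (i1.add i2) fun x hx => ?_
    have up := h.up x hx t ht0
    have vp := h.vp x hx t ht0
    have e1 : u x t * v x t = v x t ^ (2/3:ℝ) * (u x t * v x t ^ (1/3:ℝ)) := by
      have : v x t = v x t ^ (2/3:ℝ) * v x t ^ (1/3:ℝ) := by
        rw [← Real.rpow_add vp]; norm_num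
      nth_rewrite 1 [this]; ring
    have e2 : v x t ^ (2/3:ℝ) ≤ C' := Real.rpow_le_rpow vp.le (hvC t ht x hx) (by norm_num)
    have e3 : u x t * v x t ^ (1/3:ℝ) ≤ (K * (1 + J t)) ^ (5/6:ℝ) := by
      rw [X_eq up vp]
      exact Real.rpow_le_rpow (by positivity) (hk t ht x hx) (by norm_num)
    have e4 : u x t * v x t ≤ C' * (K * (1 + J t)) ^ (5/6:ℝ) := by
      rw [e1]
      exact mul_le_mul e2 e3 (mul_nonneg up.le (Real.rpow_nonneg vp.le _)) hC'0
    have e5 := mul_le_mul_of_nonneg_right e4 (mul_pos up vp).le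
    nlinarith [sq_nonneg (u x t * v x t - (B2 x t - (w x - w2 x)))]
  have hzero := ode_zero hE' (fun ε hε => by
    set A := 2 * C' * (C * M) * K * (1 + KJ) with hA
    have hA0 : 0 ≤ A := by positivity
    set δ := ε / (3 * (A + 1)) with hδ
    have hδ0 : 0 < δ := by positivity
    have hAδ : A * δ ≤ ε / 3 := by
      have : A * δ = (A / (A + 1)) * (ε / 3) := by rw [hδ]; field_simp
      rw [this]
      apply mul_le_of_le_one_left (by positivity)
      rw [div_le_one (by positivity)]; linarith
    obtain ⟨Cδ, hCδ0, hCδ⟩ := rpow_interp hδ0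
    have t1 : Tendsto (fun t => 2 * C' * Cδ * ∫ s in t..(t+1), η s) atTop (𝓝 0) := by
      simpa using tη.const_mul (2 * C' * Cδ)
    have t2 : Tendsto (fun t => 2 * ∫ s in t..(t+1), g s) atTop (𝓝 0) := by
      simpa using hg.const_mul 2
    obtain ⟨T1, hT1⟩ := eventually_atTop.1
      (t1.eventually (gt_mem_nhds (show 0 < ε / 3 by positivity)))
    obtain ⟨T2, hT2⟩ := eventually_atTop.1
      (t2.eventually (gt_mem_nhds (show 0 < ε / 3 by positivity)))
    have c1 : ContinuousOn (fun s => (2 * C' * (C * M) * K * δ) * (1 + J s)) (Ioi 0) :=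
      continuousOn_const.mul (continuousOn_const.add hJc)
    have c2 : ContinuousOn (fun s => (2 * C' * Cδ) * η s) (Ioi 0) := continuousOn_const.mul cη
    have c3 : ContinuousOn (fun s => 2 * g s) (Ioi 0) := continuousOn_const.mul cg
    refine ⟨fun s => (2 * C' * (C * M) * K * δ) * (1 + J s) + (2 * C' * Cδ) * η s + 2 * g s,
      max 1 (max T1 T2), lt_of_lt_of_le one_pos (le_max_left _ _), (c1.add c2).add c3,
      fun t ht => ?_, fun t ht => ?_, fun t ht => ?_⟩
    · have := hJ0 t ht
      have := hη0 t ht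
      have := hg0 t
      positivity
    · have ht1 : 1 ≤ t := (le_max_left _ _).trans ht
      have ht0 : 0 < t := by linarith
      have hJt := hJ0 t ht0
      have hηt := hη0 t ht0
      have h1 := hEle t ht0
      have h2 := hF t ht1
      have h3 := hCδ (K * (1 + J t)) (by positivity)
      have h4 := mul_le_mul_of_nonneg_right h3 hηt
      have h5 : δ * (K * (1 + J t)) * η t ≤ δ * (K * (1 + J t)) * (C * M) :=
        mul_le_mul_of_nonneg_left (hηM t ht1) (by positivity)
      have h6 : (K * (1 + J t)) ^ (5/6:ℝ) * η t ≤ δ * (K * (1 + J t)) * (C * M) + Cδ * η t := by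
        linarith
      have h7 := mul_le_mul_of_nonneg_left h6 (show 0 ≤ 2 * C' by positivity)
      refine h1.trans ?_
      have h8 : -((∫ x in a..b, (v x t - w x) ^ 2) + ∫ x in a..b, (vx x t - w1 x) ^ 2) = -E t := rfl
      rw [h8]
      refine (add_le_add (le_refl (-E t)) h2).trans ?_
      linarith
    · have ht1 : 1 ≤ t := (le_max_left _ _).trans ht
      have ht0 : 0 < t := by linarith
      have htt : t ≤ t + 1 := by linarith
      have h1 := hT1 t ((le_max_left _ _).trans ((le_max_right _ _).trans ht))
      have h2 := hT2 t ((le_max_right _ _).trans ((le_max_right _ _).trans ht))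
      rw [intervalIntegral.integral_add ((ii_of_pos c1 ht0 htt).add (ii_of_pos c2 ht0 htt))
        (ii_of_pos c3 ht0 htt), intervalIntegral.integral_add (ii_of_pos c1 ht0 htt)
        (ii_of_pos c2 ht0 htt), intervalIntegral.integral_const_mul,
        intervalIntegral.integral_const_mul, intervalIntegral.integral_const_mul,
        intervalIntegral.integral_add intervalIntegrable_const (ii_of_pos hJc ht0 htt),
        intervalIntegral.integral_const, smul_eq_mul]
      have h3 := mul_le_mul_of_nonneg_left (add_le_add (le_refl ((t + 1 - t) * 1)) (hKJ t ht1))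
        (show 0 ≤ 2 * C' * (C * M) * K * δ by positivity)
      have h4 : 2 * C' * (C * M) * K * δ * ((t + 1 - t) * 1 + KJ) = A * δ := by rw [hA]; ring
      rw [h4] at h3
      linarith)
  intro ε hε
  set S := 1 / (b - a) + 1 with hS
  have hS0 : 0 < S := by positivity
  obtain ⟨T, hT, hTE⟩ := hzero (ε ^ 2 / (2 * S)) (by positivity)
  refine ⟨T, hT, fun t ht x hx => ?_⟩
  have h1 := h.sobolev hw (lt_of_lt_of_le hT ht) hx
  have h2 := mul_le_mul_of_nonneg_left (hTE t ht) hS0.le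
  have h3 : S * (ε ^ 2 / (2 * S)) = ε ^ 2 / 2 := by field_simp
  rw [h3] at h2
  have h4 : (v x t - w x) ^ 2 ≤ ε ^ 2 / 2 := h1.trans h2
  apply abs_lt_of_sq_lt_sq _ hε.le
  have : 0 < ε ^ 2 := by positivity
  linarith

lemma H1_bound (hab : a < b) (hB : HypB a b B1) (hH1 : HypH1 a b B1) :
    ∃ M0 : ℝ, ∀ T : ℝ, 1 ≤ T → ∫ t in (1:ℝ)..T, ∫ x in a..b, B1 x t ≤ M0 := by
  have h1 : Integrable (fun p : ℝ × ℝ => B1 p.1 p.2)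
      ((volume.restrict (Ioo a b)).prod (volume.restrict (Ioi (0:ℝ)))) := by
    rw [Measure.prod_restrict, ← Measure.volume_eq_prod]; exact hH1
  have h2 := h1.integral_prod_right
  have h3 : ∀ t : ℝ, ∫ x in a..b, B1 x t = ∫ x in Ioo a b, B1 x t := fun t => by
    rw [intervalIntegral.integral_of_le hab.le, integral_Ioc_eq_integral_Ioo]
  refine ⟨∫ t in Ioi (0:ℝ), ∫ x in Ioo a b, B1 x t, fun T hT => ?_⟩
  simp only [h3]
  rw [intervalIntegral.integral_of_le hT]
  apply setIntegral_mono_set h2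
  · exact Eventually.of_forall fun t => integral_nonneg fun x => hB.1 x t
  · exact (show Ioc 1 T ⊆ Ioi 0 from fun t ht => lt_trans one_pos ht.1).eventuallyLE

lemma form_pos (hχ : 0 < χ) (hχ' : χ < Real.sqrt (6 * Real.sqrt 3 + 9) / 2) :
    ∃ c : ℝ, 0 < c ∧ ∀ y w : ℝ, c * (y ^ 2 + w ^ 2) ≤ (1/5) * (1 - (1/5)) * y ^ 2
        - (2 * (1/5) * (2/5) + (1/5) * (1 - (1/5)) * χ) * (y * w)
        + (2/5) * (1 - (2/5) + (1/5) * χ) * w ^ 2 := by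
  have h3 : Real.sqrt 3 < 1.8 := by
    rw [Real.sqrt_lt' (by norm_num)]; norm_num
  have h4 : Real.sqrt (6 * Real.sqrt 3 + 9) ^ 2 = 6 * Real.sqrt 3 + 9 :=
    Real.sq_sqrt (by positivity)
  have h5 : χ ^ 2 < 5 := by
    have := Real.sqrt_nonneg (6 * Real.sqrt 3 + 9)
    nlinarith
  set κ := (20 - 4 * χ ^ 2) / (10 + 2 * χ) with hκ
  have hκ0 : 0 < κ := div_pos (by linarith) (by linarith)
  have hκ1 : κ * (10 + 2 * χ) = 20 - 4 * χ ^ 2 := by rw [hκ]; field_simp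
  have hκ2 : κ < 4 := by
    rw [hκ, div_lt_iff₀ (by linarith)]; nlinarith
  refine ⟨κ / 25, by positivity, fun y w => ?_⟩
  have h6 : 0 ≤ (4 - κ) * (4 * y ^ 2 - (4 + 4 * χ) * (y * w) + (6 + 2 * χ) * w ^ 2
      - κ * (y ^ 2 + w ^ 2)) := by
    have : (4 - κ) * (4 * y ^ 2 - (4 + 4 * χ) * (y * w) + (6 + 2 * χ) * w ^ 2
      - κ * (y ^ 2 + w ^ 2)) = ((4 - κ) * y - (2 + 2 * χ) * w) ^ 2 + (κ * w) ^ 2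
        - (κ * (10 + 2 * χ) - (20 - 4 * χ ^ 2)) * w ^ 2 := by ring
    rw [this, hκ1]
    nlinarith [sq_nonneg ((4 - κ) * y - (2 + 2 * χ) * w), sq_nonneg (κ * w)]
  have h7 := nonneg_of_mul_nonneg_right h6 (by linarith)
  linarith

lemma sw_of_stat (hab : a < b) {B w : ℝ → ℝ} (hB : MemLp B 2 (volume.restrict (Ioo a b)))
    (h : IsStationarySol a b B w) : SW a b w (deriv w) (deriv (deriv w)) where
  d1 := fun x hx => (h.2.1 x hx).1.hasDerivAt
  d2 := fun x hx => (h.2.1 x hx).2.hasDerivAt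
  ba := h.2.2.2.1
  bb := h.2.2.2.2
  l2 := by
    have hr : volume.restrict (Ioo a b) = volume.restrict (Ioc a b) :=
      Measure.restrict_congr_set Ioo_ae_eq_Ioc
    have h1 : L2 a b w := L2.of_cont h.1
    unfold L2 at *
    rw [← hr] at *
    refine MemLp.ae_eq ?_ (h1.sub hB)
    rw [Filter.EventuallyEq, ae_restrict_iff' measurableSet_Ioo]
    refine Eventually.of_forall fun x hx => ?_
    have := h.2.2.1 x hx
    simp only [Pi.sub_apply]
    linarith

end Main

/-- Theorem 1.3 (boundedness of `v` under (H1) for small `χ`, and stabilization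
under (H3)). -/
theorem boundedness_and_stabilization_of_v
    (a b χ : ℝ) (hab : a < b) (hχ : 0 < χ)
    (hχ' : χ < Real.sqrt (6 * Real.sqrt 3 + 9) / 2)
    (B1 B2 : ℝ → ℝ → ℝ) (hB1 : HypB a b B1) (hB2 : HypB a b B2)
    (hH1 : HypH1 a b B1)
    (u0 v0 : ℝ → ℝ) (hinit : HypInit a b u0 v0)
    (u v : ℝ → ℝ → ℝ) (hsol : CrimeSol a b χ B1 B2 u0 v0 u v ⊤) :
    (∃ C : ℝ, 0 < C ∧ ∀ x ∈ Set.Ioo a b, ∀ t : ℝ, 0 < t → v x t ≤ C) ∧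
    (∀ B2inf : ℝ → ℝ, HypH3 a b B2 B2inf →
      ∀ vinf : ℝ → ℝ, IsStationarySol a b B2inf vinf →
        TendstoUniformlyOn (fun (t : ℝ) (x : ℝ) => v x t) vinf
          Filter.atTop (Set.Ioo a b)) := by
  have h := core_of_sol hab hB1 hB2 hsol
  obtain ⟨N1, hN1⟩ := hB1.2.1
  obtain ⟨N2, hN2⟩ := hB2.2.1
  obtain ⟨M0, hM0⟩ := H1_bound hab hB1 hH1
  obtain ⟨c, hc, hform⟩ := form_pos hχ hχ'
  obtain ⟨M1, hM10, hu1, huv1⟩ := h.mass_u hM0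
  obtain ⟨M2, hM20, hv1⟩ := h.mass_v (N := max N1 N2) hu1
    (fun x t => (hN1 x t).trans (le_max_left _ _)) (fun x t => (hN2 x t).trans (le_max_right _ _))
  set M := max M1 M2 with hM
  have hu : ∀ t : ℝ, 1 ≤ t → ∫ x in a..b, u x t ≤ M :=
    fun t ht => (hu1 t ht).trans (le_max_left _ _)
  have hv : ∀ t : ℝ, 1 ≤ t → ∫ x in a..b, v x t ≤ M :=
    fun t ht => (hv1 t ht).trans (le_max_right _ _)
  have huv : ∀ T : ℝ, 1 ≤ T → ∫ t in (1:ℝ)..T, ∫ x in a..b, u x t * v x t ≤ M :=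
    fun t ht => (huv1 t ht).trans (le_max_left _ _)
  obtain ⟨KJ, hKJ⟩ := h.est_J hc hform hu hv huv
  obtain ⟨K, hK0, hk⟩ := h.k_sup hu hv
  have hJc := ((h.cm (1/5) (2/5)).mul ((h.cy.pow 2).add (h.cw.pow 2))).cont_int hab.le
  have hJ0 : ∀ t : ℝ, 0 < t → 0 ≤ ∫ x in a..b, u x t ^ (1/5:ℝ) * v x t ^ (2/5:ℝ) *
      ((pdx u x t / u x t) ^ 2 + (pdx v x t / v x t) ^ 2) := fun t ht =>
    int_nonneg' hab.le fun x hx => mul_nonneg (h.mpos _ _ x hx t ht).le (by positivity)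
  obtain ⟨C, hC0, hC⟩ := h.v_bdd hN2 hK0 hu hJc hJ0 hKJ hk
  constructor
  · have hcomp : IsCompact (Icc a b ×ˢ Icc (0:ℝ) 1) := isCompact_Icc.prod isCompact_Icc
    obtain ⟨C1, hC1⟩ := hcomp.exists_bound_of_continuousOn
      (hsol.v_cont.mono (prod_mono le_rfl
        (fun t (ht : t ∈ Icc (0:ℝ) 1) => ⟨ht.1, ENNReal.ofReal_lt_top⟩)))
    refine ⟨max C C1 + 1, by linarith [le_max_left C C1], fun x hx t ht => ?_⟩
    have hx := Ioo_subset_Icc_self hx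
    rcases le_total t 1 with h1 | h1
    · have := hC1 (x, t) ⟨hx, ht.le, h1⟩
      have h2 := (le_abs_self _).trans this
      simp only at h2
      linarith [le_max_right C C1]
    · linarith [hC t h1 x hx, le_max_left C C1]
  · intro B2inf hH3 vinf hvinf
    have hw := sw_of_stat hab hH3.1 hvinf
    have hg : Tendsto (fun t : ℝ => ∫ s in t..(t+1), ∫ x in a..b,
        (B2 x s - (vinf x - deriv (deriv vinf) x)) ^ 2) atTop (𝓝 0) := by
      refine hH3.2.congr fun t => ?_
      congr 1; ext s
      rw [intervalIntegral.integral_of_le hab.le, integral_Ioc_eq_integral_Ioo]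
      refine setIntegral_congr_fun measurableSet_Ioo fun x hx => ?_
      have := hvinf.2.2.1 x hx
      rw [← this]; ring
    have hconv := h.v_conv hw hK0 hC0 hu huv hJc hJ0 hKJ hk hC hg
    rw [Metric.tendstoUniformlyOn_iff]
    intro ε hε
    obtain ⟨T, _, hT⟩ := hconv ε hε
    filter_upwards [eventually_ge_atTop T] with t ht x hx
    rw [dist_comm, Real.dist_eq]
    exact hT t ht x (Ioo_subset_Icc_self hx)
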